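/- arXiv:2001.08627 — 4 statements merged into one kernel-verified Lean document; each statement's English description precedes it below -/
import Mathlib

section
/- Let φ be a semiflow on E satisfying (H1), (H2) with j = 2, (H3), (COM) and (S). Let w₀ ∈ E have bounded positive semi-orbit, and suppose the ω-limit set ω(w₀) contains a terminal stationary point v₀ (i.e., v₀ is stationary and is either Lyapunov stable or possesses a 2-dimensional local unstable set). Then ω(w₀) = {v₀}. -/
open Set Filter Topology MeasureTheory Bornology

/-- A semiflow on a Banach space `E`. -/
structure Semiflow (E : Type*) [NormedAddCommGroup E] [NormedSpace ℝ E] where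
  toFun : ℝ → E → E
  map_zero' : ∀ v : E, toFun 0 v = v
  map_add' : ∀ t s : ℝ, 0 ≤ t → 0 ≤ s → ∀ v : E, toFun (t + s) v = toFun t (toFun s v)
  continuousOn' : ContinuousOn (fun p : ℝ × E => toFun p.1 p.2) (Set.Ici (0 : ℝ) ×ˢ Set.univ)

/-- The open `r`-neighborhood `O_r(γ)` of a set `γ` in a normed space. -/
def setNbhd {E : Type*} [NormedAddCommGroup E] (γ : Set E) (r : ℝ) : Set E :=
  {v | ∃ w ∈ γ, ‖v - w‖ < r}

/-- `S` is an `ε`-section at `x₀` of the (partial) flow `ξ` on the set `M`. -/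
def IsSectionOn {X : Type*} [TopologicalSpace X] (M : Set X) (ξ : ℝ → X → X)
    (ε : ℝ) (x₀ : X) (S : Set X) : Prop :=
  x₀ ∈ S ∧ S ⊆ M ∧
    (∃ W : Set X, IsOpen W ∧ x₀ ∈ W ∧
      W ∩ M ⊆ ⋃ t ∈ Set.Icc (-ε) ε, ξ t '' S) ∧
    ∀ y ∈ ⋃ t ∈ Set.Icc (-ε) ε, ξ t '' S,
      ∃! p : ℝ × X, p.1 ∈ Set.Icc (-ε) ε ∧ p.2 ∈ S ∧ ξ p.1 p.2 = y

/-- `T` is an `ε`-transversal at `x₀` of the (partial) flow `ξ` on the set `M`: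
an `ε`-section which is the image of a topological embedding of `[-1,1]`,
with `x₀` corresponding to an interior point. -/
def IsTransversalOn {X : Type*} [TopologicalSpace X] (M : Set X) (ξ : ℝ → X → X)
    (ε : ℝ) (x₀ : X) (T : Set X) : Prop :=
  IsSectionOn M ξ ε x₀ T ∧
    ∃ h : ℝ → X, ContinuousOn h (Set.Icc (-1 : ℝ) 1) ∧ Set.InjOn h (Set.Icc (-1 : ℝ) 1) ∧
      h '' Set.Icc (-1 : ℝ) 1 = T ∧ ∃ s₀ ∈ Set.Ioo (-1 : ℝ) 1, h s₀ = x₀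

namespace Semiflow

variable {E : Type*} [NormedAddCommGroup E] [NormedSpace ℝ E]
variable {H : Type*} [NormedAddCommGroup H] [InnerProductSpace ℝ H]

/-- A stationary point of the semiflow. -/
def IsStationary (φ : Semiflow E) (v₀ : E) : Prop :=
  ∀ t : ℝ, 0 ≤ t → φ.toFun t v₀ = v₀

/-- A periodic (non-stationary) point of the semiflow. -/
def IsPeriodicPt (φ : Semiflow E) (v₀ : E) : Prop :=
  ¬ φ.IsStationary v₀ ∧ ∃ σ : ℝ, 0 < σ ∧ φ.toFun σ v₀ = v₀

/-- The positive semi-orbit `γ⁺(v₀)` (which equals the full orbit for periodic points). -/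
def orbit (φ : Semiflow E) (v₀ : E) : Set E :=
  {w | ∃ t : ℝ, 0 ≤ t ∧ φ.toFun t v₀ = w}

/-- `γ` is a periodic orbit of the semiflow. -/
def IsPeriodicOrbit (φ : Semiflow E) (γ : Set E) : Prop :=
  ∃ v₀ : E, φ.IsPeriodicPt v₀ ∧ γ = φ.orbit v₀

/-- The ω-limit set of a point. -/
def omegaLimit (φ : Semiflow E) (v₀ : E) : Set E :=
  ⋂ s ∈ Set.Ici (0 : ℝ), closure {w | ∃ t : ℝ, s ≤ t ∧ φ.toFun t v₀ = w}

/-- A complete trajectory of the semiflow. -/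
def IsCompleteTrajectory (φ : Semiflow E) (v : ℝ → E) : Prop :=
  Continuous v ∧ ∀ t : ℝ, 0 ≤ t → ∀ s : ℝ, v (t + s) = φ.toFun t (v s)

/-- The α-limit set of a complete trajectory. -/
def alphaLimitOf (φ : Semiflow E) (v : ℝ → E) : Set E :=
  ⋂ s ∈ Set.Iic (0 : ℝ), closure {w | ∃ t : ℝ, t ≤ s ∧ v t = w}

/-- Hypothesis (H1): `P` is symmetric and positive on `Eplus`, negative on `Eminus`,
with `E = Eplus ⊕ Eminus`. -/
def IsH1 (P : E →L[ℝ] E →L[ℝ] ℝ) (Eplus Eminus : Submodule ℝ E) : Prop :=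
  (∀ v w : E, P v w = P w v) ∧ IsClosed (Eplus : Set E) ∧ IsClosed (Eminus : Set E) ∧
    IsCompl Eplus Eminus ∧
    (∀ v ∈ Eplus, v ≠ 0 → 0 < P v v) ∧ (∀ v ∈ Eminus, v ≠ 0 → P v v < 0)

/-- Hypothesis (H3): squeezing with respect to `V(v) = ⟨v, Pv⟩`, with parameters
`δ > 0`, `τV ≥ 0`, `ν > 0`; the embedding `E ↪ H` is `ι`. -/
def IsH3 (φ : Semiflow E) (ι : E →L[ℝ] H) (P : E →L[ℝ] E →L[ℝ] ℝ) (δ τV ν : ℝ) : Prop :=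
  0 < δ ∧ 0 ≤ τV ∧ 0 < ν ∧
    ∀ v₁ v₂ : E, ∀ l r : ℝ, 0 ≤ l → l ≤ r → τV ≤ r - l →
      Real.exp (2 * ν * r) *
          P (φ.toFun r v₁ - φ.toFun r v₂) (φ.toFun r v₁ - φ.toFun r v₂) -
        Real.exp (2 * ν * l) *
          P (φ.toFun l v₁ - φ.toFun l v₂) (φ.toFun l v₁ - φ.toFun l v₂) ≤
      -δ * ∫ s in l..r, Real.exp (2 * ν * s) * ‖ι (φ.toFun s v₁) - ι (φ.toFun s v₂)‖ ^ 2

/-- Hypothesis (COM): some time-`τ` map takes bounded sets to precompact sets. -/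
def IsCOM (φ : Semiflow E) : Prop :=
  ∃ τ : ℝ, 0 < τ ∧ ∀ B : Set E, IsBounded B → IsCompact (closure (φ.toFun τ '' B))

/-- Hypothesis (S): a smoothing estimate from `H` to `E`. -/
def IsSmoothing (φ : Semiflow E) (ι : E →L[ℝ] H) : Prop :=
  ∃ τ C : ℝ, 0 ≤ τ ∧ 0 < C ∧
    ∀ v₁ v₂ : E, ‖φ.toFun τ v₁ - φ.toFun τ v₂‖ ≤ C * ‖ι v₁ - ι v₂‖

/-- An amenable trajectory: a complete trajectory with
`∫_{-∞}^0 e^{2νs} |v(s)|²_H ds < ∞`. -/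
def IsAmenableTrajectory (φ : Semiflow E) (ι : E →L[ℝ] H) (ν : ℝ) (v : ℝ → E) : Prop :=
  φ.IsCompleteTrajectory v ∧
    IntegrableOn (fun s : ℝ => Real.exp (2 * ν * s) * ‖ι (v s)‖ ^ 2) (Set.Iic (0 : ℝ))

/-- The amenable set `𝔄`: points through which an amenable trajectory passes. -/
def amenableSet (φ : Semiflow E) (ι : E →L[ℝ] H) (ν : ℝ) : Set E :=
  {v₀ | ∃ v : ℝ → E, φ.IsAmenableTrajectory ι ν v ∧ v 0 = v₀}

/-- Orbital stability of a set `γ`. -/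
def IsOrbitallyStable (φ : Semiflow E) (γ : Set E) : Prop :=
  ∀ ε : ℝ, 0 < ε → ∃ δ : ℝ, 0 < δ ∧
    ∀ v ∈ setNbhd γ δ, ∀ t : ℝ, 0 ≤ t → φ.toFun t v ∈ setNbhd γ ε

/-- Amenable stability: orbital stability with respect to initial data in `𝔄`. -/
def IsAmenableStable (φ : Semiflow E) (ι : E →L[ℝ] H) (ν : ℝ) (γ : Set E) : Prop :=
  ∀ ε : ℝ, 0 < ε → ∃ δ : ℝ, 0 < δ ∧
    ∀ v ∈ setNbhd γ δ ∩ φ.amenableSet ι ν, ∀ t : ℝ, 0 ≤ t → φ.toFun t v ∈ setNbhd γ ε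

/-- Lyapunov stability of a stationary point. -/
def IsLyapunovStable (φ : Semiflow E) (v₀ : E) : Prop :=
  ∀ ε : ℝ, 0 < ε → ∃ δ : ℝ, 0 < δ ∧
    ∀ v : E, ‖v - v₀‖ < δ → ∀ t : ℝ, 0 ≤ t → ‖φ.toFun t v - v₀‖ < ε

/-- `D` is a `k`-dimensional local unstable set for the stationary point `v₀`:
(U1) `D` is a homeomorphic image of an open `k`-cube; (U2) through every point of `D`
there is a unique complete trajectory, converging to `v₀` as `t → -∞`;
(U3) trajectories through points of `D` near `v₀` stay near `v₀` for `t ≤ 0`. -/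
def IsLocalUnstableSet (φ : Semiflow E) (k : ℕ) (v₀ : E) (D : Set E) : Prop :=
  v₀ ∈ D ∧
    Nonempty (↥(Set.pi Set.univ fun _ : Fin k => Set.Ioo (0 : ℝ) 1) ≃ₜ ↥D) ∧
    (∀ w₀ ∈ D, ∃! w : ℝ → E, φ.IsCompleteTrajectory w ∧ w 0 = w₀) ∧
    (∀ w₀ ∈ D, ∀ w : ℝ → E, φ.IsCompleteTrajectory w → w 0 = w₀ →
      Filter.Tendsto w Filter.atBot (nhds v₀)) ∧
    (∀ ε : ℝ, 0 < ε → ∃ δ : ℝ, 0 < δ ∧ ∀ w₀ ∈ D, ‖w₀ - v₀‖ < δ →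
      ∀ w : ℝ → E, φ.IsCompleteTrajectory w → w 0 = w₀ → ∀ t : ℝ, t ≤ 0 → ‖w t - v₀‖ < ε)

/-- An unstable terminal point: a stationary point with a 2-dimensional local unstable set. -/
def IsUnstableTerminal (φ : Semiflow E) (v₀ : E) : Prop :=
  φ.IsStationary v₀ ∧ ∃ D : Set E, φ.IsLocalUnstableSet 2 v₀ D

/-- A terminal point: a stationary point that is Lyapunov stable or has a
2-dimensional local unstable set. -/
def IsTerminal (φ : Semiflow E) (v₀ : E) : Prop :=
  φ.IsStationary v₀ ∧
    (φ.IsLyapunovStable v₀ ∨ ∃ D : Set E, φ.IsLocalUnstableSet 2 v₀ D)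

/-- An attractor: a bounded closed set with an open neighborhood all of whose points have
precompact positive semi-orbits with ω-limit sets inside the set. -/
def IsAttractor (φ : Semiflow E) (A : Set E) : Prop :=
  IsBounded A ∧ IsClosed A ∧
    ∃ U : Set E, IsOpen U ∧ A ⊆ U ∧
      ∀ v₀ ∈ U, IsCompact (closure (φ.orbit v₀)) ∧ φ.omegaLimit v₀ ⊆ A

/-- `Pi` is the `V`-orthogonal projector onto `Eminus`. -/
def IsVProjector (P : E →L[ℝ] E →L[ℝ] ℝ) (Eminus : Submodule ℝ E) (Pi : E → E) : Prop :=
  ∀ v : E, Pi v ∈ Eminus ∧ ∀ w ∈ Eminus, P w v = P w (Pi v)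

/-- The interior region `𝒢_γ ⊆ 𝔄` of a periodic orbit `γ`: the preimage under `Π`
of the bounded connected component of `E⁻ \ Πγ`. -/
def interiorRegion (φ : Semiflow E) (ι : E →L[ℝ] H) (ν : ℝ) (Eminus : Submodule ℝ E)
    (Pi : E → E) (γ : Set E) : Set E :=
  {a | a ∈ φ.amenableSet ι ν ∧ Pi a ∈ (Eminus : Set E) \ (Pi '' γ) ∧
    IsBounded (connectedComponentIn ((Eminus : Set E) \ (Pi '' γ)) (Pi a))}

/-- The partial order `γ₁ ⩽ γ₂` on periodic orbits: `𝒢_{γ₁} ⊆ 𝒢_{γ₂}`. -/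
def orbitLE (φ : Semiflow E) (ι : E →L[ℝ] H) (ν : ℝ) (Eminus : Submodule ℝ E)
    (Pi : E → E) (γ₁ γ₂ : Set E) : Prop :=
  φ.interiorRegion ι ν Eminus Pi γ₁ ⊆ φ.interiorRegion ι ν Eminus Pi γ₂

/-- External stability of a periodic orbit `γ`. -/
def IsExternallyStable (φ : Semiflow E) (ι : E →L[ℝ] H) (ν : ℝ) (Eminus : Submodule ℝ E)
    (Pi : E → E) (γ : Set E) : Prop :=
  (∃ g : ℕ → Set E, (∀ k, φ.IsPeriodicOrbit (g k)) ∧ (∀ k, g k ≠ γ) ∧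
      (∀ k, φ.orbitLE ι ν Eminus Pi γ (g k)) ∧
      Filter.Tendsto (fun k => Metric.hausdorffDist (g k) γ) Filter.atTop (nhds 0)) ∨
    (∃ v₀ ∈ φ.amenableSet ι ν \ closure (φ.interiorRegion ι ν Eminus Pi γ),
      φ.omegaLimit v₀ = γ)

/-- Internal stability of a periodic orbit `γ`. -/
def IsInternallyStable (φ : Semiflow E) (ι : E →L[ℝ] H) (ν : ℝ) (Eminus : Submodule ℝ E)
    (Pi : E → E) (γ : Set E) : Prop :=
  (∃ g : ℕ → Set E, (∀ k, φ.IsPeriodicOrbit (g k)) ∧ (∀ k, g k ≠ γ) ∧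
      (∀ k, φ.orbitLE ι ν Eminus Pi (g k) γ) ∧
      Filter.Tendsto (fun k => Metric.hausdorffDist (g k) γ) Filter.atTop (nhds 0)) ∨
    (∃ v₀ ∈ φ.interiorRegion ι ν Eminus Pi γ, φ.omegaLimit v₀ = γ)

end Semiflow


def HasCLog {X : Type*} [TopologicalSpace X] (f : C(X, ℂ)) : Prop :=
  ∃ h : C(X, ℂ), ∀ x, f x = Complex.exp (h x)

theorem HasCLog.ne {X : Type*} [TopologicalSpace X] {f : C(X, ℂ)} (hf : HasCLog f) (x : X) :
    f x ≠ 0 := by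
  obtain ⟨h, hh⟩ := hf
  rw [hh]; exact Complex.exp_ne_zero _

theorem HasCLog.close {X : Type*} [TopologicalSpace X] {f g : C(X, ℂ)} (hf : HasCLog f)
    (hfg : ∀ x, ‖g x - f x‖ < ‖f x‖) : HasCLog g := by
  have hne := hf.ne
  obtain ⟨h, hh⟩ := hf
  have hs : ∀ x, g x / f x ∈ Complex.slitPlane := by
    intro x
    have h1 : ‖g x / f x - 1‖ < 1 := by
      have : g x / f x - 1 = (g x - f x) / f x := by
        field_simp [hne x]
      rw [this, norm_div, div_lt_one (norm_pos_iff.2 (hne x))]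
      exact hfg x
    left
    have h2 := Complex.abs_re_le_norm (g x / f x - 1)
    have h3 := (abs_lt.1 (h2.trans_lt h1)).1
    simp only [Complex.sub_re, Complex.one_re] at h3
    linarith
  have hg : ∀ x, g x ≠ 0 := by
    intro x h0
    have := hfg x
    rw [h0] at this
    simp at this
  refine ⟨⟨fun x => h x + Complex.log (g x / f x), ?_⟩, ?_⟩
  · refine h.continuous.add (Continuous.clog ?_ hs)
    exact g.continuous.div f.continuous hne
  · intro x
    simp only [ContinuousMap.coe_mk]
    rw [Complex.exp_add, ← hh x, Complex.exp_log (div_ne_zero (hg x) (hne x))]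
    field_simp [hne x]

theorem HasCLog.close' {X : Type*} [TopologicalSpace X] {f g : C(X, ℂ)} (hf : HasCLog f)
    (hfg : ∀ x, ‖g x - f x‖ < ‖g x‖) : HasCLog g := by
  have hne := hf.ne
  obtain ⟨h, hh⟩ := hf
  have hg : ∀ x, g x ≠ 0 := by
    intro x h0
    have := hfg x
    rw [h0] at this
    simp at this
    exact absurd this (not_lt.2 (norm_nonneg _))
  have hs : ∀ x, f x / g x ∈ Complex.slitPlane := by
    intro x
    have h1 : ‖f x / g x - 1‖ < 1 := by
      have : f x / g x - 1 = (f x - g x) / g x := by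
        field_simp [hg x]
      rw [this, norm_div, div_lt_one (norm_pos_iff.2 (hg x)), norm_sub_rev]
      exact hfg x
    left
    have h2 := Complex.abs_re_le_norm (f x / g x - 1)
    have h3 := (abs_lt.1 (h2.trans_lt h1)).1
    simp only [Complex.sub_re, Complex.one_re] at h3
    linarith
  refine ⟨⟨fun x => h x - Complex.log (f x / g x), ?_⟩, ?_⟩
  · refine h.continuous.sub (Continuous.clog ?_ hs)
    exact f.continuous.div g.continuous hg
  · intro x
    simp only [ContinuousMap.coe_mk]
    rw [Complex.exp_sub, ← hh x, Complex.exp_log (div_ne_zero (hne x) (hg x))]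
    field_simp [hne x, hg x]

theorem HasCLog.homotopy {X : Type*} [TopologicalSpace X] [CompactSpace X]
    (F : C(unitInterval × X, ℂ)) (hF : ∀ p, F p ≠ 0) (h0 : HasCLog (F.curry 0)) :
    HasCLog (F.curry 1) := by
  obtain ⟨m, hm, hmF⟩ : ∃ m > 0, ∀ p, m ≤ ‖F p‖ := by
    rcases isEmpty_or_nonempty (unitInterval × X) with he | he
    · exact ⟨1, one_pos, fun p => he.elim p⟩
    · obtain ⟨p, -, hp⟩ := isCompact_univ.exists_isMinOn univ_nonempty
        (continuous_norm.comp F.continuous).continuousOn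
      exact ⟨‖F p‖, norm_pos_iff.2 (hF p), fun q => hp (mem_univ q)⟩
  have hc : Continuous (fun t => F.curry t) := F.curry.continuous
  have key : ∀ t0 : unitInterval, ∀ᶠ t in 𝓝 t0, (HasCLog (F.curry t) ↔ HasCLog (F.curry t0)) := by
    intro t0
    have := Metric.continuous_iff'.1 hc t0 m hm
    filter_upwards [this] with t ht
    have h1 : ∀ x, ‖F.curry t x - F.curry t0 x‖ < m := by
      intro x
      rw [← dist_eq_norm]
      exact (ContinuousMap.dist_apply_le_dist x).trans_lt ht
    refine ⟨fun h => h.close' fun x => ?_, fun h => h.close' fun x => ?_⟩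
    · rw [norm_sub_rev]; exact (h1 x).trans_le (hmF _)
    · exact (h1 x).trans_le (hmF _)
  have hclop : IsClopen {t | HasCLog (F.curry t)} := by
    constructor
    · rw [← isOpen_compl_iff, isOpen_iff_mem_nhds]
      intro t ht
      filter_upwards [key t] with s hs h
      exact ht (hs.1 h)
    · rw [isOpen_iff_mem_nhds]
      intro t ht
      filter_upwards [key t] with s hs
      exact hs.2 ht
  have := hclop.eq_univ ⟨0, h0⟩
  have h1 : (1 : unitInterval) ∈ {t | HasCLog (F.curry t)} := by rw [this]; trivial
  exact h1

theorem disc_hasCLog (f : C(Metric.closedBall (0 : ℂ) 1, ℂ)) (hf : ∀ x, f x ≠ 0) : HasCLog f := by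
  have hmem : ∀ (p : unitInterval × Metric.closedBall (0 : ℂ) 1),
      ((p.1 : ℝ) : ℂ) * (p.2 : ℂ) ∈ Metric.closedBall (0 : ℂ) 1 := by
    rintro ⟨⟨t, ht0, ht1⟩, ⟨x, hx⟩⟩
    simp only [mem_closedBall_zero_iff, norm_mul, Complex.norm_real, Real.norm_eq_abs,
      abs_of_nonneg ht0] at hx ⊢
    exact mul_le_one₀ ht1 (norm_nonneg _) hx
  let F : C(unitInterval × Metric.closedBall (0 : ℂ) 1, ℂ) :=
    ⟨fun p => f ⟨((p.1 : ℝ) : ℂ) * (p.2 : ℂ), hmem p⟩, by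
      apply f.continuous.comp
      apply Continuous.subtype_mk
      fun_prop⟩
  have h := HasCLog.homotopy F (fun p => hf _) ?_
  · have : F.curry 1 = f := by
      ext x
      simp [F]
    rwa [this] at h
  · refine ⟨ContinuousMap.const _ (Complex.log (f ⟨0, by simp⟩)), fun x => ?_⟩
    simp [F, Complex.exp_log (hf _)]

theorem odd_no_log (f : C(Metric.sphere (0 : ℂ) 1, ℂ)) (hodd : ∀ x, f (-x) = - f x) :
    ¬ HasCLog f := by
  rintro ⟨h, hh⟩
  let k : Metric.sphere (0 : ℂ) 1 → ℂ := fun x => (h (-x) - h x) / (Real.pi * Complex.I)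
  have hpi : ((Real.pi : ℂ) * Complex.I) ≠ 0 := by simp [Real.pi_ne_zero]
  have hk : ∀ x, ∃ n : ℤ, k x = 2 * n + 1 := by
    intro x
    have h1 : Complex.exp (h (-x) - h x - Real.pi * Complex.I) = 1 := by
      rw [Complex.exp_sub, Complex.exp_sub, ← hh, ← hh, hodd, Complex.exp_pi_mul_I]
      have : f x ≠ 0 := by rw [hh]; exact Complex.exp_ne_zero _
      field_simp
    obtain ⟨n, hn⟩ := Complex.exp_eq_one_iff.1 h1
    refine ⟨n, ?_⟩
    simp only [k]
    rw [div_eq_iff hpi]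
    linear_combination hn
  choose n hn using hk
  have hkc : Continuous k := by
    simp only [k]
    fun_prop
  have hconn : IsPreconnected (Metric.sphere (0 : ℂ) 1) := by
    apply isPreconnected_sphere
    rw [Complex.rank_real_complex]; norm_num
  have : PreconnectedSpace (Metric.sphere (0 : ℂ) 1) := isPreconnected_iff_preconnectedSpace.1 hconn
  have hnc : Continuous n := by
    have he : Topology.IsClosedEmbedding ((↑) : ℤ → ℂ) := Complex.isClosedEmbedding_intCast
    rw [he.isInducing.continuous_iff]
    have : ((↑) : ℤ → ℂ) ∘ n = fun x => (k x - 1) / 2 := by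
      ext x
      simp only [Function.comp]
      rw [hn x]; ring
    rw [this]
    fun_prop
  let x0 : Metric.sphere (0 : ℂ) 1 := ⟨1, by simp⟩
  have h1 : n (-x0) = n x0 := PreconnectedSpace.constant inferInstance hnc
  have h2 : k (-x0) = - k x0 := by
    simp only [k, neg_neg]; ring
  rw [hn, hn, h1] at h2
  have h3 : (4 * (n x0 : ℤ) + 2 : ℂ) = 0 := by linear_combination h2
  have h4 : 4 * n x0 + 2 = 0 := by exact_mod_cast h3
  omega

theorem inv_domain_disc (f : C(Metric.closedBall (0 : ℂ) 1, ℂ)) (hf : Function.Injective f)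
    : range f ∈ 𝓝 (f ⟨0, by simp⟩) := by
  set o : Metric.closedBall (0 : ℂ) 1 := ⟨0, by simp⟩ with ho
  let i : C(Metric.sphere (0 : ℂ) 1, Metric.closedBall (0 : ℂ) 1) :=
    ⟨fun x => ⟨x, Metric.sphere_subset_closedBall x.2⟩, by fun_prop⟩
  have hio : ∀ x, i x ≠ o := by
    intro x hx
    have h1 : (x : ℂ) = 0 := congrArg Subtype.val hx
    have h2 := x.2
    rw [h1] at h2
    simp at h2
  have : CompactSpace (Metric.sphere (0 : ℂ) 1) := isCompact_iff_compactSpace.1 (isCompact_sphere _ _)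
  have : Nonempty (Metric.sphere (0 : ℂ) 1) := ⟨⟨1, by simp⟩⟩
  obtain ⟨x1, -, hx1'⟩ := isCompact_univ.exists_isMinOn univ_nonempty
    (show Continuous fun x => ‖f (i x) - f o‖ by fun_prop).continuousOn
  have hx1 : ∀ x, ‖f (i x1) - f o‖ ≤ ‖f (i x) - f o‖ := fun x => hx1' (mem_univ x)
  have hm : 0 < ‖f (i x1) - f o‖ := norm_pos_iff.2 (sub_ne_zero.2 fun h => hio _ (hf h))
  refine mem_of_superset (Metric.ball_mem_nhds _ hm) fun y hy => ?_
  by_contra hyr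
  have h1 : HasCLog (f - ContinuousMap.const _ y) := by
    apply disc_hasCLog
    intro x hx
    exact hyr ⟨x, sub_eq_zero.1 hx⟩
  have h2 : HasCLog ((f - ContinuousMap.const _ y).comp i) := by
    obtain ⟨h, hh⟩ := h1
    exact ⟨h.comp i, fun x => hh _⟩
  have h3 : HasCLog (f.comp i - ContinuousMap.const _ (f o)) := by
    apply h2.close'
    intro x
    have := hx1 x
    have hy' : ‖y - f o‖ < ‖f (i x1) - f o‖ := by rwa [Metric.mem_ball, dist_eq_norm] at hy
    simp only [ContinuousMap.sub_apply, ContinuousMap.comp_apply, ContinuousMap.const_apply]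
    have e : f (i x) - f o - (f (i x) - y) = y - f o := by ring
    rw [e]
    exact hy'.trans_le this
  have hmem1 : ∀ (p : unitInterval × Metric.sphere (0 : ℂ) 1),
      ((1 / (1 + (p.1 : ℝ)) : ℝ) : ℂ) * (p.2 : ℂ) ∈ Metric.closedBall (0 : ℂ) 1 := by
    rintro ⟨⟨t, ht0, ht1⟩, ⟨x, hx⟩⟩
    rw [mem_sphere_zero_iff_norm] at hx
    rw [mem_closedBall_zero_iff, norm_mul, Complex.norm_real, Real.norm_eq_abs]
    dsimp only
    rw [abs_of_nonneg (by positivity), hx, mul_one, div_le_one (by linarith)]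
    linarith
  have hmem2 : ∀ (p : unitInterval × Metric.sphere (0 : ℂ) 1),
      ((-(p.1 : ℝ) / (1 + (p.1 : ℝ)) : ℝ) : ℂ) * (p.2 : ℂ) ∈ Metric.closedBall (0 : ℂ) 1 := by
    rintro ⟨⟨t, ht0, ht1⟩, ⟨x, hx⟩⟩
    rw [mem_sphere_zero_iff_norm] at hx
    rw [mem_closedBall_zero_iff, norm_mul, Complex.norm_real, Real.norm_eq_abs]
    dsimp only
    rw [neg_div, abs_neg, abs_of_nonneg (by positivity), hx, mul_one, div_le_one (by linarith)]
    linarith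
  have hpos : ∀ t : unitInterval, (1 + (t : ℝ)) ≠ 0 := fun t => by have := t.2.1; linarith
  let F : C(unitInterval × Metric.sphere (0 : ℂ) 1, ℂ) :=
    ⟨fun p => f ⟨((1 / (1 + (p.1 : ℝ)) : ℝ) : ℂ) * (p.2 : ℂ), hmem1 p⟩
        - f ⟨((-(p.1 : ℝ) / (1 + (p.1 : ℝ)) : ℝ) : ℂ) * (p.2 : ℂ), hmem2 p⟩, by
      apply Continuous.sub
      · apply f.continuous.comp
        apply Continuous.subtype_mk
        refine (Complex.continuous_ofReal.comp ?_).mul (by fun_prop)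
        exact Continuous.div (by fun_prop) (by fun_prop) fun p => hpos _
      · apply f.continuous.comp
        apply Continuous.subtype_mk
        refine (Complex.continuous_ofReal.comp ?_).mul (by fun_prop)
        exact Continuous.div (by fun_prop) (by fun_prop) fun p => hpos _⟩
  have h4 : HasCLog (F.curry 1) := by
    apply HasCLog.homotopy
    · rintro ⟨t, x⟩ h0
      have h1 := congrArg Subtype.val (hf (sub_eq_zero.1 h0))
      simp only at h1
      have hx0 : (x : ℂ) ≠ 0 := fun h => hio x (Subtype.ext h)
      have h2 := mul_right_cancel₀ hx0 h1
      have h3 : (1 / (1 + (t : ℝ)) : ℝ) = -(t : ℝ) / (1 + (t : ℝ)) := by exact_mod_cast h2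
      rw [div_left_inj' (hpos t)] at h3
      have := t.2.1
      linarith
    · have : F.curry 0 = f.comp i - ContinuousMap.const _ (f o) := by
        ext x
        simp [F, i, ho]
      rwa [this]
  refine odd_no_log _ ?_ h4
  intro x
  simp only [F, ContinuousMap.curry_apply, ContinuousMap.coe_mk, neg_sub]
  congr 3
  · simp; ring
  · simp; ring

/-- Planar invariance of domain, for maps with values in a plane `F`. -/
theorem inv_domain_plane {F : Type*} [NormedAddCommGroup F] [NormedSpace ℝ F]
    [FiniteDimensional ℝ F] (hF : Module.finrank ℝ F = 2)
    (g : ↥(Set.pi Set.univ fun _ : Fin 2 => Set.Ioo (0 : ℝ) 1) → F) (hg : Continuous g)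
    (hgi : Function.Injective g) (p : ↥(Set.pi Set.univ fun _ : Fin 2 => Set.Ioo (0 : ℝ) 1)) :
    range g ∈ 𝓝 (g p) := by
  let L : ℂ ≃L[ℝ] (Fin 2 → ℝ) := ContinuousLinearEquiv.ofFinrankEq (by simp)
  let M : F ≃L[ℝ] ℂ := ContinuousLinearEquiv.ofFinrankEq (by simp [hF])
  have hopen : IsOpen (Set.pi Set.univ fun _ : Fin 2 => Set.Ioo (0 : ℝ) 1) :=
    isOpen_set_pi finite_univ fun _ _ => isOpen_Ioo
  have hnhds : L ⁻¹' (Set.pi Set.univ fun _ : Fin 2 => Set.Ioo (0 : ℝ) 1) ∈ 𝓝 (L.symm p) := by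
    apply L.continuous.continuousAt.preimage_mem_nhds
    rw [L.apply_symm_apply]
    exact hopen.mem_nhds p.2
  obtain ⟨R, hR, hball⟩ := Metric.nhds_basis_closedBall.mem_iff.1 hnhds
  have hmem : ∀ x : Metric.closedBall (0 : ℂ) 1,
      L (L.symm p + R • (x : ℂ)) ∈ (Set.pi Set.univ fun _ : Fin 2 => Set.Ioo (0 : ℝ) 1) := by
    rintro ⟨x, hx⟩
    apply hball
    rw [mem_closedBall_zero_iff] at hx
    rw [Metric.mem_closedBall, dist_eq_norm, add_sub_cancel_left, norm_smul, Real.norm_eq_abs,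
      abs_of_pos hR]
    nlinarith
  let f : C(Metric.closedBall (0 : ℂ) 1, ℂ) :=
    ⟨fun x => M (g ⟨L (L.symm p + R • (x : ℂ)), hmem x⟩), by
      apply M.continuous.comp
      apply hg.comp
      apply Continuous.subtype_mk
      fun_prop⟩
  have hf : Function.Injective f := by
    intro x y hxy
    have h1 := congrArg Subtype.val (hgi (M.injective hxy))
    have h2 := add_left_cancel (L.injective h1)
    exact Subtype.ext (smul_right_injective ℂ hR.ne' h2)
  have h := inv_domain_disc f hf
  have hf0 : f ⟨0, by simp⟩ = M (g p) := by
    simp [f]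
  rw [hf0] at h
  have h5 := M.continuous.continuousAt.preimage_mem_nhds h
  refine mem_of_superset h5 ?_
  rintro y ⟨x, hx⟩
  exact ⟨_, M.injective hx⟩

section Dyn
variable {E : Type*} [NormedAddCommGroup E] [NormedSpace ℝ E]
variable {H : Type*} [NormedAddCommGroup H] [InnerProductSpace ℝ H]

theorem sf_cont (φ : Semiflow E) {t : ℝ} (ht : 0 ≤ t) : Continuous (φ.toFun t) := by
  have := φ.continuousOn'.comp (f := fun v : E => (t, v)) (s := univ) (by fun_prop)
    (fun v _ => ⟨ht, trivial⟩)
  exact continuousOn_univ.1 this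

theorem sf_traj_cont (φ : Semiflow E) (v : E) : ContinuousOn (fun t => φ.toFun t v) (Ici 0) :=
  φ.continuousOn'.comp (f := fun t : ℝ => (t, v)) (s := Ici 0) (by fun_prop)
    (fun _ ht => ⟨ht, trivial⟩)

theorem mem_omega_iff (φ : Semiflow E) (p x : E) :
    x ∈ φ.omegaLimit p ↔ ∀ s : ℝ, 0 ≤ s → ∀ ε > 0, ∃ t, s ≤ t ∧ ‖φ.toFun t p - x‖ < ε := by
  simp only [Semiflow.omegaLimit, mem_iInter, Metric.mem_closure_iff, mem_Ici, mem_ofPred_eq]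
  refine forall₄_congr fun s hs ε hε => ?_
  constructor
  · rintro ⟨_, ⟨t, ht, rfl⟩, h⟩
    exact ⟨t, ht, by rwa [dist_eq_norm, norm_sub_rev] at h⟩
  · rintro ⟨t, ht, h⟩
    exact ⟨_, ⟨t, ht, rfl⟩, by rwa [dist_eq_norm, norm_sub_rev]⟩

theorem omega_closed (φ : Semiflow E) (p : E) : IsClosed (φ.omegaLimit p) :=
  isClosed_biInter fun _ _ => isClosed_closure

theorem mem_omega_of_seq (φ : Semiflow E) {p x : E} {t : ℕ → ℝ} (ht : Tendsto t atTop atTop)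
    (hx : Tendsto (fun n => φ.toFun (t n) p) atTop (𝓝 x)) : x ∈ φ.omegaLimit p := by
  rw [mem_omega_iff]
  intro s hs ε hε
  have h1 := (Metric.tendsto_nhds.1 hx ε hε).and (ht.eventually_ge_atTop s)
  obtain ⟨n, h1, h2⟩ := h1.exists
  exact ⟨t n, h2, by rwa [dist_eq_norm] at h1⟩

theorem exists_seq_of_mem_omega (φ : Semiflow E) {p x : E} (hx : x ∈ φ.omegaLimit p) :
    ∃ t : ℕ → ℝ, (∀ n : ℕ, (n : ℝ) ≤ t n) ∧ Tendsto (fun n => φ.toFun (t n) p) atTop (𝓝 x) := by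
  rw [mem_omega_iff] at hx
  choose t ht1 ht2 using fun n : ℕ => hx n (Nat.cast_nonneg n) (1 / ((n : ℝ) + 1)) (by positivity)
  refine ⟨t, ht1, ?_⟩
  rw [tendsto_iff_norm_sub_tendsto_zero]
  exact squeeze_zero (fun _ => norm_nonneg _) (fun n => (ht2 n).le)
    tendsto_one_div_add_atTop_nhds_zero_nat

theorem seq_atTop {t : ℕ → ℝ} (h : ∀ n : ℕ, (n : ℝ) ≤ t n) : Tendsto t atTop atTop :=
  tendsto_atTop_mono h tendsto_natCast_atTop_atTop

def TailCpt (φ : Semiflow E) (p : E) (C : Set E) : Prop :=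
  IsCompact C ∧ ∃ T : ℝ, ∀ t, T ≤ t → φ.toFun t p ∈ C

theorem omega_subset (φ : Semiflow E) {p : E} {C : Set E} (hC : TailCpt φ p C) :
    φ.omegaLimit p ⊆ C := by
  intro x hx
  obtain ⟨t, ht, htx⟩ := exists_seq_of_mem_omega φ hx
  obtain ⟨hc, T, hT⟩ := hC
  exact hc.isClosed.mem_of_tendsto htx
    (((seq_atTop ht).eventually_ge_atTop T).mono fun n hn => hT _ hn)

/-- Extract a limit point along a sequence of times. -/
theorem exists_lim (φ : Semiflow E) {p : E} {C : Set E} (hC : TailCpt φ p C) {t : ℕ → ℝ}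
    (ht : Tendsto t atTop atTop) : ∃ y ∈ φ.omegaLimit p, ∃ σ : ℕ → ℕ, StrictMono σ ∧
      Tendsto (fun n => φ.toFun (t (σ n)) p) atTop (𝓝 y) := by
  obtain ⟨hc, T, hT⟩ := hC
  have h1 : ∃ᶠ n in atTop, φ.toFun (t n) p ∈ C :=
    ((ht.eventually_ge_atTop T).mono fun n hn => hT _ hn).frequently
  obtain ⟨y, -, σ, hσ, hy⟩ := hc.tendsto_subseq' h1
  exact ⟨y, mem_omega_of_seq φ (ht.comp hσ.tendsto_atTop) hy, σ, hσ, hy⟩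

theorem omega_forward (φ : Semiflow E) {p x : E} (hx : x ∈ φ.omegaLimit p) {s : ℝ} (hs : 0 ≤ s) :
    φ.toFun s x ∈ φ.omegaLimit p := by
  obtain ⟨t, ht, htx⟩ := exists_seq_of_mem_omega φ hx
  have h1 := ((sf_cont φ hs).tendsto x).comp htx
  refine mem_omega_of_seq φ (t := fun n => s + t n)
    (tendsto_atTop_add_const_left _ _ (seq_atTop ht)) (h1.congr fun n => ?_)
  rw [φ.map_add' _ _ hs ((Nat.cast_nonneg n).trans (ht n))]
  rfl

theorem omega_backward (φ : Semiflow E) {p x : E} {C : Set E} (hC : TailCpt φ p C)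
    (hx : x ∈ φ.omegaLimit p) : ∃ y ∈ φ.omegaLimit p, φ.toFun 1 y = x := by
  obtain ⟨t, ht, htx⟩ := exists_seq_of_mem_omega φ hx
  obtain ⟨y, hy, σ, hσ, hlim⟩ := exists_lim φ hC (t := fun n => t n - 1)
    (tendsto_atTop_add_const_right _ _ (seq_atTop ht))
  refine ⟨y, hy, ?_⟩
  have h1 := ((sf_cont φ zero_le_one).tendsto y).comp hlim
  have h2 := htx.comp hσ.tendsto_atTop
  refine tendsto_nhds_unique h1 (h2.congr' ?_)
  filter_upwards [eventually_ge_atTop 1] with n hn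
  have h3 : (1 : ℝ) ≤ t (σ n) := by
    have : (1 : ℝ) ≤ (σ n : ℝ) := by exact_mod_cast hn.trans (hσ.id_le n)
    exact this.trans (ht _)
  simp only [Function.comp]
  rw [← φ.map_add' _ _ zero_le_one (by linarith)]
  congr 1; ring

theorem omega_complete (φ : Semiflow E) {p x : E} {C : Set E} (hC : TailCpt φ p C)
    (hx : x ∈ φ.omegaLimit p) : ∃ v : ℝ → E, φ.IsCompleteTrajectory v ∧ v 0 = x ∧
      ∀ t, v t ∈ φ.omegaLimit p := by
  choose g hg1 hg2 using fun z : φ.omegaLimit p => omega_backward φ hC z.2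
  let y : ℕ → φ.omegaLimit p := fun n => (fun z => ⟨g z, hg1 z⟩)^[n] ⟨x, hx⟩
  have hy0 : (y 0 : E) = x := rfl
  have hy1 : ∀ n, φ.toFun 1 (y (n + 1)) = y n := by
    intro n
    simp only [y, Function.iterate_succ_apply']
    exact hg2 _
  have hyk : ∀ k n : ℕ, φ.toFun k (y (n + k)) = y n := by
    intro k
    induction k with
    | zero => intro n; simpa using φ.map_zero' _
    | succ k ih =>
      intro n
      push_cast
      rw [φ.map_add' _ _ (Nat.cast_nonneg k) zero_le_one, ← add_assoc, hy1, ih]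
  have hcons : ∀ (t : ℝ) (n k : ℕ), 0 ≤ t + n →
      φ.toFun (t + (n + k : ℕ)) (y (n + k)) = φ.toFun (t + n) (y n) := by
    intro t n k h
    push_cast
    rw [← add_assoc, φ.map_add' _ _ h (Nat.cast_nonneg k), hyk]
  let v : ℝ → E := fun t => φ.toFun (t + ⌈-t⌉₊) (y ⌈-t⌉₊)
  have hN : ∀ t : ℝ, 0 ≤ t + ⌈-t⌉₊ := fun t => by
    have := Nat.le_ceil (-t); linarith
  have hv : ∀ (t : ℝ) (n : ℕ), 0 ≤ t + n → v t = φ.toFun (t + n) (y n) := by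
    intro t n h
    have h1 : ⌈-t⌉₊ ≤ n := Nat.ceil_le.2 (by linarith)
    obtain ⟨k, rfl⟩ := Nat.exists_eq_add_of_le h1
    exact (hcons t _ k (hN t)).symm
  refine ⟨v, ⟨?_, ?_⟩, ?_, ?_⟩
  · rw [continuous_iff_continuousAt]
    intro t0
    obtain ⟨n, hn⟩ := exists_nat_gt (-t0)
    have hev : ∀ᶠ t in 𝓝 t0, v t = φ.toFun (t + n) (y n) := by
      filter_upwards [lt_mem_nhds (show -(n : ℝ) < t0 by linarith)] with t ht
      exact hv t n (by linarith)
    refine ContinuousAt.congr ?_ (hev.mono fun _ h => h.symm)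
    have h1 : ContinuousAt (fun t => φ.toFun t (y n)) (t0 + n) :=
      (sf_traj_cont φ (y n)).continuousAt (Ici_mem_nhds (by linarith))
    exact ContinuousAt.comp (f := fun t : ℝ => t + (n : ℝ)) h1 (by fun_prop)
  · intro t ht s
    rw [hv s _ (hN s), hv (t + s) ⌈-s⌉₊ (by have := hN s; linarith),
      ← φ.map_add' _ _ ht (hN s), add_assoc]
  · rw [hv 0 0 (by simp), ← hy0]
    simpa using φ.map_zero' _
  · intro t
    exact omega_forward φ (y _).2 (hN t)

/-- The form `V` is nonpositive on differences of trajectories bounded in the past. -/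
theorem V_nonpos (φ : Semiflow E) (ι : E →L[ℝ] H) (P : E →L[ℝ] E →L[ℝ] ℝ) {δ τV ν : ℝ}
    (hH3 : φ.IsH3 ι P δ τV ν) {a b : ℝ → E} (ha : φ.IsCompleteTrajectory a)
    (hb : φ.IsCompleteTrajectory b) {B : ℝ} (hB : ∀ t ≤ 0, ‖a t - b t‖ ≤ B) {t : ℝ} (ht : t ≤ 0) :
    P (a t - b t) (a t - b t) ≤ 0 := by
  obtain ⟨hδ, hτ, hν, h⟩ := hH3
  have key : ∀ L : ℝ, τV ≤ L → P (a t - b t) (a t - b t) ≤ Real.exp (-(2 * ν * L)) * (‖P‖ * B * B) := by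
    intro L hL
    have hL0 := hτ.trans hL
    have h1 := h (a (t - L)) (b (t - L)) 0 L le_rfl hL0 (by simpa using hL)
    rw [← ha.2 L hL0, ← hb.2 L hL0, φ.map_zero', φ.map_zero'] at h1
    simp only [add_sub_cancel, mul_zero, Real.exp_zero, one_mul] at h1
    have h2 : 0 ≤ ∫ s in (0 : ℝ)..L, Real.exp (2 * ν * s) *
        ‖ι (φ.toFun s (a (t - L))) - ι (φ.toFun s (b (t - L)))‖ ^ 2 :=
      intervalIntegral.integral_nonneg hL0 fun s _ => by positivity
    have h3 : P (a (t - L) - b (t - L)) (a (t - L) - b (t - L)) ≤ ‖P‖ * B * B := by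
      refine (le_abs_self _).trans ?_
      rw [← Real.norm_eq_abs]
      refine (P.le_opNorm₂ _ _).trans ?_
      have := hB (t - L) (by linarith)
      have hB0 : 0 ≤ B := (norm_nonneg _).trans this
      gcongr
    have h4 : Real.exp (2 * ν * L) * P (a t - b t) (a t - b t) ≤ ‖P‖ * B * B := by nlinarith
    rw [Real.exp_neg, inv_mul_eq_div, le_div_iff₀ (Real.exp_pos _), mul_comm]
    exact h4
  have hlim : Tendsto (fun L : ℝ => Real.exp (-(2 * ν * L)) * (‖P‖ * B * B)) atTop (𝓝 (0 * (‖P‖ * B * B))) := by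
    apply Tendsto.mul_const
    refine Real.tendsto_exp_neg_atTop_nhds_zero.comp ?_
    exact Tendsto.const_mul_atTop (by positivity) tendsto_id
  rw [zero_mul] at hlim
  exact ge_of_tendsto hlim ((eventually_ge_atTop τV).mono key)

theorem V_neg (φ : Semiflow E) (ι : E →L[ℝ] H) (hι : Function.Injective ι)
    (P : E →L[ℝ] E →L[ℝ] ℝ) {δ τV ν : ℝ}
    (hH3 : φ.IsH3 ι P δ τV ν) {a b : ℝ → E} (ha : φ.IsCompleteTrajectory a)
    (hb : φ.IsCompleteTrajectory b) {B : ℝ} (hB : ∀ t ≤ 0, ‖a t - b t‖ ≤ B) (hne : a 0 ≠ b 0) :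
    P (a 0 - b 0) (a 0 - b 0) < 0 := by
  have hnp := fun t (ht : t ≤ 0) => V_nonpos φ ι P hH3 ha hb hB ht
  obtain ⟨hδ, hτ, hν, h⟩ := hH3
  set T := τV + 1 with hT
  have hT0 : 0 < T := by linarith
  have h1 := h (a (-T)) (b (-T)) 0 T le_rfl hT0.le (by linarith)
  have h0 := hnp (-T) (by linarith)
  have e : ∀ s ∈ Icc 0 T, Real.exp (2 * ν * s) *
        ‖ι (φ.toFun s (a (-T))) - ι (φ.toFun s (b (-T)))‖ ^ 2 = Real.exp (2 * ν * s) *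
        ‖ι (a (s + -T)) - ι (b (s + -T))‖ ^ 2 := by
    intro s hs
    rw [ha.2 s hs.1, hb.2 s hs.1]
  have h2 : 0 < ∫ s in (0 : ℝ)..T, Real.exp (2 * ν * s) *
        ‖ι (φ.toFun s (a (-T))) - ι (φ.toFun s (b (-T)))‖ ^ 2 := by
    rw [intervalIntegral.integral_congr (g := fun s => Real.exp (2 * ν * s) *
        ‖ι (a (s + -T)) - ι (b (s + -T))‖ ^ 2) (by rw [uIcc_of_le hT0.le]; exact e)]
    apply intervalIntegral.integral_pos hT0
    · have := ha.1
      have := hb.1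
      fun_prop
    · intro s _; positivity
    · refine ⟨T, ⟨hT0.le, le_rfl⟩, ?_⟩
      have : ι (a 0) - ι (b 0) ≠ 0 := sub_ne_zero.2 fun hh => hne (hι hh)
      simp only [add_neg_cancel]
      positivity
  rw [← ha.2 T hT0.le, ← hb.2 T hT0.le, φ.map_zero', φ.map_zero'] at h1
  simp only [add_neg_cancel, mul_zero, Real.exp_zero, one_mul] at h1
  have h3 : Real.exp (2 * ν * T) * P (a 0 - b 0) (a 0 - b 0) < 0 := by nlinarith
  by_contra hc
  push Not at hc
  have := mul_nonneg (Real.exp_pos (2 * ν * T)).le hc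
  linarith


theorem past_bdd {a : ℝ → E} (ha : Continuous a) {v₀ : E} (h : Tendsto a atBot (𝓝 v₀)) :
    ∃ B, ∀ t ≤ 0, ‖a t‖ ≤ B := by
  obtain ⟨T, hT⟩ := eventually_atBot.1 (Metric.tendsto_nhds.1 h 1 one_pos)
  obtain ⟨B, hB⟩ := (isCompact_Icc (a := T) (b := 0)).exists_bound_of_continuousOn ha.continuousOn
  refine ⟨max B (‖v₀‖ + 1), fun t ht => ?_⟩
  rcases le_total t T with h1 | h1
  · have h2 := hT t h1
    rw [dist_eq_norm] at h2
    have h3 := norm_le_norm_add_norm_sub' (a t) v₀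
    exact le_max_of_le_right (by linarith)
  · exact le_max_of_le_left (hB t ⟨h1, ht⟩)

theorem near_mem_D (ι : E →L[ℝ] H) (hι : Function.Injective ι)
    (φ : Semiflow E) (P : E →L[ℝ] E →L[ℝ] ℝ) (Eplus Eminus : Submodule ℝ E)
    (hH1 : Semiflow.IsH1 P Eplus Eminus)
    [FiniteDimensional ℝ ↥Eminus] (hH2 : Module.finrank ℝ ↥Eminus = 2)
    {δ τV ν : ℝ} (hH3 : φ.IsH3 ι P δ τV ν) {w₀ v₀ : E} {C : Set E} (hC : TailCpt φ w₀ C)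
    {D : Set E} (hD : φ.IsLocalUnstableSet 2 v₀ D) :
    ∃ r > 0, ∀ x ∈ φ.omegaLimit w₀, ‖x - v₀‖ ≤ r → x ∈ D := by
  obtain ⟨hvD, ⟨h⟩, hU2, hU2', -⟩ := hD
  obtain ⟨-, hcl, -, hcompl, hpos, -⟩ := hH1
  have : IsClosed (Eplus : Set E) := hcl
  let eq := Submodule.quotientEquivOfIsCompl Eplus Eminus hcompl
  have hfd : FiniteDimensional ℝ (E ⧸ Eplus) := Module.Finite.equiv eq.symm
  have hfr : Module.finrank ℝ (E ⧸ Eplus) = 2 := by rw [eq.finrank_eq, hH2]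
  let q : E → E ⧸ Eplus := Eplus.mkQL
  have hq : Continuous q := Eplus.mkQL.continuous
  have inj : ∀ a b : ℝ → E, φ.IsCompleteTrajectory a → φ.IsCompleteTrajectory b →
      (∃ B, ∀ t ≤ 0, ‖a t‖ ≤ B) → (∃ B, ∀ t ≤ 0, ‖b t‖ ≤ B) → q (a 0) = q (b 0) → a 0 = b 0 := by
    rintro a b ha hb ⟨B1, hB1⟩ ⟨B2, hB2⟩ hab
    by_contra hne
    have h1 := V_neg φ ι hι P hH3 ha hb (B := B1 + B2)
      (fun t ht => (norm_sub_le _ _).trans (add_le_add (hB1 t ht) (hB2 t ht))) hne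
    have h2 : a 0 - b 0 ∈ Eplus := (Submodule.Quotient.eq Eplus).1 hab
    have h3 := hpos _ h2 (sub_ne_zero.2 hne)
    linarith
  have hDtraj : ∀ d ∈ D, ∃ a : ℝ → E, φ.IsCompleteTrajectory a ∧ a 0 = d ∧
      ∃ B, ∀ t ≤ 0, ‖a t‖ ≤ B := by
    intro d hd
    obtain ⟨a, ⟨ha, ha0⟩, -⟩ := hU2 d hd
    exact ⟨a, ha, ha0, past_bdd ha.1 (hU2' d hd a ha ha0)⟩
  have hdom := inv_domain_plane hfr (fun x => q (h x)) (hq.comp (continuous_subtype_val.comp h.continuous))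
    (by
      intro x y hxy
      obtain ⟨a, ha, ha0, haB⟩ := hDtraj _ (h x).2
      obtain ⟨b, hb, hb0, hbB⟩ := hDtraj _ (h y).2
      have := inj a b ha hb haB hbB (by rw [ha0, hb0]; exact hxy)
      rw [ha0, hb0] at this
      exact h.injective (Subtype.ext this)) (h.symm ⟨v₀, hvD⟩)
  simp only [Homeomorph.apply_symm_apply] at hdom
  obtain ⟨r, hr, hball⟩ := Metric.nhds_basis_closedBall.mem_iff.1
    (hq.continuousAt.preimage_mem_nhds hdom)
  refine ⟨r, hr, fun x hx hxr => ?_⟩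
  obtain ⟨y, hy⟩ := hball (show x ∈ Metric.closedBall v₀ r by
    rwa [Metric.mem_closedBall, dist_eq_norm])
  obtain ⟨a, ha, ha0, haω⟩ := omega_complete φ hC hx
  obtain ⟨b, hb, hb0, hbB⟩ := hDtraj _ (h y).2
  obtain ⟨B, hB⟩ := hC.1.isBounded.exists_norm_le
  have := inj a b ha hb ⟨B, fun t _ => hB _ (omega_subset φ hC (haω t))⟩ hbB
    (by rw [ha0, hb0]; exact hy.symm)
  rw [← ha0, this, hb0]
  exact (h y).2

theorem entry (φ : Semiflow E) {w₀ v₀ u : E} (hv : v₀ ∈ φ.omegaLimit w₀)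
    (hu : u ∈ φ.omegaLimit w₀) {r : ℝ} (hr : 0 < r) (hru : r < ‖u - v₀‖) (n : ℕ) :
    ∃ s t : ℝ, (n : ℝ) ≤ s ∧ s ≤ t ∧ r ≤ ‖φ.toFun s w₀ - v₀‖ ∧
      (∀ x, s < x → x ≤ t → ‖φ.toFun x w₀ - v₀‖ ≤ r) ∧
      ‖φ.toFun t w₀ - v₀‖ < 1 / ((n : ℝ) + 1) := by
  rw [mem_omega_iff] at hv hu
  obtain ⟨α, hα, hα2⟩ := hu n (Nat.cast_nonneg n) (‖u - v₀‖ - r) (by linarith)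
  have hα0 : 0 ≤ α := (Nat.cast_nonneg n).trans hα
  obtain ⟨t, ht, ht2⟩ := hv α hα0 (1 / ((n : ℝ) + 1)) (by positivity)
  have hαr : r ≤ ‖φ.toFun α w₀ - v₀‖ := by
    have := norm_sub_le_norm_sub_add_norm_sub u (φ.toFun α w₀) v₀
    rw [norm_sub_rev] at hα2
    linarith
  have hc : ContinuousOn (fun x => ‖φ.toFun x w₀ - v₀‖) (Icc α t) :=
    (((sf_traj_cont φ w₀).mono fun x hx => hα0.trans hx.1).sub continuousOn_const).norm
  have hcl := hc.preimage_isClosed_of_isClosed isClosed_Icc (isClosed_Ici (a := r))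
  have hcpt : IsCompact (Icc α t ∩ (fun x => ‖φ.toFun x w₀ - v₀‖) ⁻¹' Ici r) :=
    isCompact_Icc.of_isClosed_subset hcl inter_subset_left
  obtain ⟨s, ⟨⟨hs1, hs2⟩, hs3⟩, hs4⟩ := hcpt.exists_isGreatest ⟨α, ⟨le_rfl, ht⟩, hαr⟩
  refine ⟨s, t, hα.trans hs1, hs2, hs3, fun x hx hxt => ?_, ht2⟩
  by_contra hcon
  push Not at hcon
  exact absurd (hs4 ⟨⟨hs1.trans hx.le, hxt⟩, hcon.le⟩) (not_le.2 hx)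

theorem const_unique (φ : Semiflow E) {v₀ : E} (hst : φ.IsStationary v₀) {D : Set E}
    (hD : φ.IsLocalUnstableSet 2 v₀ D) {a : ℝ → E} (ha : φ.IsCompleteTrajectory a) {τ : ℝ}
    (hτ : a τ = v₀) (t : ℝ) : a t = v₀ := by
  have h1 := (hD.2.2.1 v₀ hD.1).unique (y₁ := fun t => a (t + τ)) (y₂ := fun _ => v₀)
    ⟨⟨ha.1.comp (by fun_prop), fun t ht s => by beta_reduce; rw [add_assoc]; exact ha.2 t ht _⟩, by simpa using hτ⟩
    ⟨⟨continuous_const, fun t ht s => (hst t ht).symm⟩, rfl⟩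
  have := congrFun h1 (t - τ)
  simpa using this

theorem unstable_case (φ : Semiflow E) {w₀ v₀ : E} {C : Set E} (hC : TailCpt φ w₀ C)
    (hst : φ.IsStationary v₀) {D : Set E} (hD : φ.IsLocalUnstableSet 2 v₀ D)
    (hv : v₀ ∈ φ.omegaLimit w₀) {r0 : ℝ} (hr0 : 0 < r0)
    (hr0D : ∀ x ∈ φ.omegaLimit w₀, ‖x - v₀‖ ≤ r0 → x ∈ D) {u : E}
    (hu : u ∈ φ.omegaLimit w₀) : u = v₀ := by
  by_contra hne
  have hupos : 0 < ‖u - v₀‖ := norm_pos_iff.2 (sub_ne_zero.2 hne)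
  obtain ⟨r, hr, hrr⟩ := exists_between (lt_min hr0 hupos)
  have hrr0 : r ≤ r0 := (hrr.trans_le (min_le_left _ _)).le
  choose s t hns hst' hsr hx ht using entry φ hv hu hr (hrr.trans_le (min_le_right _ _))
  obtain ⟨y, hyω, σ, hσ, hlim⟩ := exists_lim φ hC (seq_atTop hns)
  have hs0 : ∀ n, 0 ≤ s n := fun n => (Nat.cast_nonneg n).trans (hns n)
  obtain ⟨a, ha, ha0, haω⟩ := omega_complete φ hC hyω
  have hyr : r ≤ ‖y - v₀‖ :=
    ge_of_tendsto (hlim.sub_const v₀).norm (Eventually.of_forall fun n => hsr _)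
  have htlim : Tendsto (fun n => φ.toFun (t n) w₀) atTop (𝓝 v₀) := by
    rw [tendsto_iff_norm_sub_tendsto_zero]
    exact squeeze_zero (fun _ => norm_nonneg _) (fun n => (ht n).le)
      tendsto_one_div_add_atTop_nhds_zero_nat
  -- the transit times go to infinity
  have hinf : ∀ M : ℝ, ∀ᶠ n in atTop, M ≤ t (σ n) - s (σ n) := by
    intro M
    by_contra hcon
    rw [not_eventually] at hcon
    have hfr : ∃ᶠ n in atTop, t (σ n) - s (σ n) ∈ Icc 0 M :=
      hcon.mono fun n hn => ⟨sub_nonneg.2 (hst' _), (not_le.1 hn).le⟩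
    obtain ⟨τ, hτ, κ, hκ, hlimτ⟩ := isCompact_Icc.tendsto_subseq' hfr
    have h1 : Tendsto (fun n => (t (σ (κ n)) - s (σ (κ n)), φ.toFun (s (σ (κ n))) w₀)) atTop
        (𝓝[Ici (0 : ℝ) ×ˢ univ] (τ, y)) := by
      apply tendsto_nhdsWithin_of_tendsto_nhds_of_eventually_within
      · exact hlimτ.prodMk_nhds (hlim.comp hκ.tendsto_atTop)
      · exact Eventually.of_forall fun n => ⟨sub_nonneg.2 (hst' _), trivial⟩
    have h2 := (φ.continuousOn' (τ, y) ⟨hτ.1, trivial⟩).tendsto.comp h1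
    have h3 := htlim.comp (hσ.comp hκ).tendsto_atTop
    have h4 : φ.toFun τ y = v₀ := by
      refine tendsto_nhds_unique h2 (h3.congr fun n => ?_)
      simp only [Function.comp]
      rw [← φ.map_add' _ _ (sub_nonneg.2 (hst' _)) (hs0 _), sub_add_cancel]
    have h5 : a τ = v₀ := by
      rw [← h4, ← ha0, ← ha.2 τ hτ.1, add_zero]
    have h6 := const_unique φ hst hD ha h5 0
    rw [ha0] at h6
    rw [h6] at hyr
    simp at hyr
    linarith
  have hfwd : ∀ x, 0 < x → ‖φ.toFun x y - v₀‖ ≤ r := by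
    intro x hx0
    have h1 := ((sf_cont φ hx0.le).tendsto y).comp hlim
    refine le_of_tendsto (h1.sub_const v₀).norm ?_
    filter_upwards [hinf x] with n hn
    simp only [Function.comp]
    rw [← φ.map_add' _ _ hx0.le (hs0 _)]
    exact hx _ _ (by linarith) (by linarith)
  have hfwd' : ∀ x, 0 ≤ x → ‖φ.toFun x y - v₀‖ ≤ r := by
    intro x hx0
    rcases hx0.eq_or_lt with h0 | h0
    · rw [← h0]
      have hc : ContinuousWithinAt (fun x => ‖φ.toFun x y - v₀‖) (Ioi 0) 0 :=
        (((sf_traj_cont φ y 0 self_mem_Ici).mono Ioi_subset_Ici_self).sub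
          continuousWithinAt_const).norm
      exact le_of_tendsto hc (eventually_mem_nhdsWithin.mono fun x hx => hfwd x hx)
    · exact hfwd x h0
  have hC' : TailCpt φ y (φ.omegaLimit w₀ ∩ Metric.closedBall v₀ r) := by
    refine ⟨?_, 0, fun x hx0 => ⟨omega_forward φ hyω hx0, ?_⟩⟩
    · exact (hC.1.of_isClosed_subset (omega_closed φ w₀) (omega_subset φ hC)).inter_right
        Metric.isClosed_closedBall
    · rw [Metric.mem_closedBall, dist_eq_norm]
      exact hfwd' x hx0
  obtain ⟨z, hz, -⟩ := exists_lim φ hC' (t := fun n : ℕ => (n : ℝ)) tendsto_natCast_atTop_atTop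
  have hz' := omega_subset φ hC' hz
  have hzD : z ∈ D := by
    refine hr0D z hz'.1 ?_
    have := hz'.2
    rw [Metric.mem_closedBall, dist_eq_norm] at this
    exact this.trans hrr0
  obtain ⟨b, hb, hb0, hbω⟩ := omega_complete φ hC' hz
  have hv₀y : v₀ ∈ φ.omegaLimit y :=
    (omega_closed φ y).mem_of_tendsto (hD.2.2.2.1 z hzD b hb hb0) (Eventually.of_forall hbω)
  obtain ⟨η, hη, hU3⟩ := hD.2.2.2.2 r hr
  obtain ⟨T, hT0, hT⟩ := (mem_omega_iff φ y v₀).1 hv₀y 0 le_rfl η hη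
  have haT : a T = φ.toFun T y := by
    rw [← ha0, ← ha.2 T hT0, add_zero]
  have h1 := hU3 (φ.toFun T y) (hr0D _ (omega_forward φ hyω hT0) ((hfwd' T hT0).trans hrr0)) hT
    (fun x => a (x + T))
    ⟨ha.1.comp (by fun_prop), fun t ht s => by beta_reduce; rw [add_assoc]; exact ha.2 t ht _⟩
    (by simpa using haT) (-T) (by linarith)
  simp only [neg_add_cancel, ha0] at h1
  linarith

theorem lyap_case (φ : Semiflow E) {w₀ v₀ : E} (hL : φ.IsLyapunovStable v₀)
    (hv : v₀ ∈ φ.omegaLimit w₀) {u : E} (hu : u ∈ φ.omegaLimit w₀) : u = v₀ := by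
  by_contra hne
  have hupos : 0 < ‖u - v₀‖ := norm_pos_iff.2 (sub_ne_zero.2 hne)
  obtain ⟨η, hη, h⟩ := hL (‖u - v₀‖ / 2) (by linarith)
  obtain ⟨T, hT0, hT⟩ := (mem_omega_iff φ w₀ v₀).1 hv 0 le_rfl η hη
  obtain ⟨t, ht, ht2⟩ := (mem_omega_iff φ w₀ u).1 hu T hT0 (‖u - v₀‖ / 2) (by linarith)
  have h1 := h _ hT (t - T) (by linarith)
  rw [← φ.map_add' _ _ (by linarith) hT0, sub_add_cancel] at h1
  have := norm_sub_le_norm_sub_add_norm_sub u (φ.toFun t w₀) v₀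
  rw [norm_sub_rev] at ht2
  linarith

theorem tail_cpt (φ : Semiflow E) (hCOM : φ.IsCOM) {w₀ : E} (hbdd : IsBounded (φ.orbit w₀)) :
    ∃ C, TailCpt φ w₀ C := by
  obtain ⟨τ, hτ, h⟩ := hCOM
  refine ⟨_, h _ hbdd, τ, fun t ht => subset_closure ⟨φ.toFun (t - τ) w₀, ⟨t - τ, by linarith, rfl⟩, ?_⟩⟩
  rw [← φ.map_add' _ _ hτ.le (by linarith)]
  congr 1; ring

end Dyn

/-- Corollary 3: if the ω-limit set of a point with bounded positive semi-orbit contains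
a terminal stationary point `v₀`, then it equals `{v₀}`. -/
theorem omegaLimit_eq_of_terminal
    {E : Type*} [NormedAddCommGroup E] [NormedSpace ℝ E]
    {H : Type*} [NormedAddCommGroup H] [InnerProductSpace ℝ H]
    (ι : E →L[ℝ] H) (hι : Function.Injective ι)
    (φ : Semiflow E)
    (P : E →L[ℝ] E →L[ℝ] ℝ) (Eplus Eminus : Submodule ℝ E)
    (hH1 : Semiflow.IsH1 P Eplus Eminus)
    [FiniteDimensional ℝ ↥Eminus] (hH2 : Module.finrank ℝ ↥Eminus = 2)
    (δ τV ν : ℝ) (hH3 : φ.IsH3 ι P δ τV ν)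
    (hCOM : φ.IsCOM) (hS : φ.IsSmoothing ι)
    (w₀ : E) (hbdd : IsBounded (φ.orbit w₀))
    (v₀ : E) (hv₀ : v₀ ∈ φ.omegaLimit w₀) (hterm : φ.IsTerminal v₀) :
    φ.omegaLimit w₀ = {v₀} := by
  obtain ⟨hst, hL | ⟨D, hD⟩⟩ := hterm
  · exact Subset.antisymm (fun u hu => lyap_case φ hL hv₀ hu) (singleton_subset_iff.2 hv₀)
  · obtain ⟨C, hC⟩ := tail_cpt φ hCOM hbdd
    obtain ⟨r, hr, hrD⟩ := near_mem_D ι hι φ P Eplus Eminus hH1 hH2 hH3 hC hD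
    exact Subset.antisymm (fun u hu => unstable_case φ hC hst hD hv₀ hr hrD hu)
      (singleton_subset_iff.2 hv₀)
end

section
/- Let φ be a semiflow on E satisfying (H1), (H3) and (S), and let v₁(·), v₂(·) be two amenable trajectories of φ with v₁(t₀) ≠ v₂(t₀) for some t₀ ∈ ℝ. Then V(v₁(t) − v₂(t)) < 0 for all t ∈ ℝ, where V(v) := ⟨v, Pv⟩. -/
open Set Filter Topology MeasureTheory Bornology

/-- Lemma 1: two distinct amenable trajectories satisfy `V(v₁(t) − v₂(t)) < 0`
for all `t ∈ ℝ`. -/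
theorem amenable_trajectories_V_neg
    {E : Type*} [NormedAddCommGroup E] [NormedSpace ℝ E]
    {H : Type*} [NormedAddCommGroup H] [InnerProductSpace ℝ H]
    (ι : E →L[ℝ] H) (hι : Function.Injective ι)
    (φ : Semiflow E)
    (P : E →L[ℝ] E →L[ℝ] ℝ) (Eplus Eminus : Submodule ℝ E)
    (hH1 : Semiflow.IsH1 P Eplus Eminus)
    (δ τV ν : ℝ) (hH3 : φ.IsH3 ι P δ τV ν)
    (hS : φ.IsSmoothing ι)
    (v₁ v₂ : ℝ → E)
    (h₁ : φ.IsAmenableTrajectory ι ν v₁) (h₂ : φ.IsAmenableTrajectory ι ν v₂)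
    (t₀ : ℝ) (hne : v₁ t₀ ≠ v₂ t₀) :
    ∀ t : ℝ, P (v₁ t - v₂ t) (v₁ t - v₂ t) < 0 := by
  obtain ⟨-, -, -, -, -, -⟩ := hH1
  obtain ⟨hδ, hτV, hν, hH3⟩ := hH3
  obtain ⟨τ, C, hτ, hC, hS⟩ := hS
  obtain ⟨⟨hc₁, ht₁⟩, hi₁⟩ := h₁
  obtain ⟨⟨hc₂, ht₂⟩, hi₂⟩ := h₂
  set f : ℝ → ℝ := fun s => Real.exp (2 * ν * s) * ‖ι (v₁ s) - ι (v₂ s)‖ ^ 2 with hf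
  have hfc : Continuous f := by
    have := ι.continuous
    fun_prop
  have hf0 : ∀ s, 0 ≤ f s := fun s => by positivity
  have hfint : IntegrableOn f (Set.Iic (0 : ℝ)) := by
    refine Integrable.mono' ((hi₁.const_mul 2).add (hi₂.const_mul 2)) hfc.aestronglyMeasurable ?_
    refine Eventually.of_forall fun s => ?_
    rw [Real.norm_of_nonneg (hf0 s)]
    have h1 : ‖ι (v₁ s) - ι (v₂ s)‖ ^ 2 ≤ 2 * ‖ι (v₁ s)‖ ^ 2 + 2 * ‖ι (v₂ s)‖ ^ 2 := by
      have := norm_sub_le (ι (v₁ s)) (ι (v₂ s))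
      have h3 := norm_nonneg (ι (v₁ s) - ι (v₂ s))
      nlinarith [sq_nonneg (‖ι (v₁ s)‖ - ‖ι (v₂ s)‖)]
    have h2 := mul_le_mul_of_nonneg_left h1 (Real.exp_pos (2 * ν * s)).le
    simp only [hf, Pi.add_apply]
    linarith
  -- small values arbitrarily far in the past
  have hsmall : ∀ ε : ℝ, 0 < ε → ∀ a : ℝ, ∃ s ≤ a, f s < ε := by
    intro ε hε a
    by_contra! hcon
    have hint : IntegrableOn f (Set.Iic (min a 0)) :=
      hfint.mono_set (Set.Iic_subset_Iic.2 (min_le_right _ _))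
    have hconst : IntegrableOn (fun _ : ℝ => ε) (Set.Iic (min a 0)) := by
      refine Integrable.mono' hint aestronglyMeasurable_const ?_
      refine (ae_restrict_iff' measurableSet_Iic).2 (Eventually.of_forall fun s hs => ?_)
      rw [Real.norm_of_nonneg hε.le]
      exact hcon s (le_trans hs (min_le_left _ _))
    rw [integrableOn_const_iff] at hconst
    rcases hconst with h | h
    · simp [hε.ne'] at h
    · simp [Real.volume_Iic] at h
  -- nonvanishing before t₀
  have hpos : ∀ s ≤ t₀, 0 < f s := by
    intro s hs
    have hne' : v₁ s ≠ v₂ s := by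
      intro h
      apply hne
      have e1 := ht₁ (t₀ - s) (by linarith) s
      have e2 := ht₂ (t₀ - s) (by linarith) s
      rw [sub_add_cancel] at e1 e2
      rw [e1, e2, h]
    have : 0 < ‖ι (v₁ s) - ι (v₂ s)‖ := norm_pos_iff.2 (sub_ne_zero.2 (hι.ne hne'))
    positivity
  -- the basic inequality
  have hbasic : ∀ l r : ℝ, l ≤ r → τV ≤ r - l →
      Real.exp (2 * ν * r) * P (v₁ r - v₂ r) (v₁ r - v₂ r) -
        Real.exp (2 * ν * l) * P (v₁ l - v₂ l) (v₁ l - v₂ l) ≤ -δ * ∫ s in l..r, f s := by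
    intro l r hlr hτ'
    have h := hH3 (v₁ l) (v₂ l) 0 (r - l) le_rfl (by linarith) (by linarith)
    have e1 := ht₁ (r - l) (by linarith) l
    have e2 := ht₂ (r - l) (by linarith) l
    rw [sub_add_cancel] at e1 e2
    rw [← e1, ← e2, φ.map_zero', φ.map_zero'] at h
    have hI : ∫ s in (0 : ℝ)..(r - l), Real.exp (2 * ν * s) *
        ‖ι (φ.toFun s (v₁ l)) - ι (φ.toFun s (v₂ l))‖ ^ 2 =
        Real.exp (-(2 * ν * l)) * ∫ s in l..r, f s := by
      have hsub : ∫ s in (0 : ℝ)..(r - l), f (s + l) = ∫ s in l..r, f s := by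
        rw [intervalIntegral.integral_comp_add_right (f := f) l]
        simp
      rw [← hsub, ← intervalIntegral.integral_const_mul]
      refine intervalIntegral.integral_congr fun s hs => ?_
      rw [Set.uIcc_of_le (by linarith)] at hs
      simp only [hf]
      rw [ht₁ s hs.1 l, ht₂ s hs.1 l, ← mul_assoc, ← Real.exp_add]
      congr 2
      ring
    rw [hI] at h
    have h' := mul_le_mul_of_nonneg_left h (Real.exp_pos (2 * ν * l)).le
    have a1 : Real.exp (2 * ν * l) * Real.exp (2 * ν * (r - l)) = Real.exp (2 * ν * r) := by
      rw [← Real.exp_add]; congr 1; ring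
    have a2 : Real.exp (2 * ν * l) * Real.exp (-(2 * ν * l)) = 1 := by
      rw [← Real.exp_add]; simp
    have a3 : Real.exp (2 * ν * 0) = 1 := by simp
    rw [a3, one_mul, mul_sub, ← mul_assoc, a1] at h'
    calc _ ≤ _ := h'
      _ = -δ * ((Real.exp (2 * ν * l) * Real.exp (-(2 * ν * l))) * ∫ s in l..r, f s) := by ring
      _ = _ := by rw [a2, one_mul]
  intro r
  set m : ℝ := min t₀ r - 1 with hm
  have hmt : m + 1 ≤ t₀ := by rw [hm, sub_add_cancel]; exact min_le_left _ _
  have hmr : m + 1 ≤ r := by rw [hm, sub_add_cancel]; exact min_le_right _ _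
  have hcpos : 0 < ∫ s in m..(m + 1), f s := by
    refine intervalIntegral.intervalIntegral_pos_of_pos_on (hfc.intervalIntegrable _ _) ?_
      (by linarith)
    intro s hs
    exact hpos s (by linarith [hs.2])
  set c := ∫ s in m..(m + 1), f s with hc
  set K : ℝ := ‖P‖ * C ^ 2 * Real.exp (2 * ν * τ) with hK
  have hK0 : 0 ≤ K := by positivity
  obtain ⟨s, hs, hfs⟩ := hsmall (δ * c / (K + 1)) (by positivity) (min m (r - τV) - τ)
  set l := s + τ with hl
  have hlm : l ≤ m := by linarith [min_le_left m (r - τV)]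
  have hlτ : l ≤ r - τV := by linarith [min_le_right m (r - τV)]
  have hb := hbasic l r (by linarith) (by linarith)
  have hge : c ≤ ∫ x in l..r, f x :=
    intervalIntegral.integral_mono_interval hlm (by linarith) hmr
      (Eventually.of_forall hf0) (hfc.intervalIntegrable _ _)
  have hV : Real.exp (2 * ν * l) * P (v₁ l - v₂ l) (v₁ l - v₂ l) ≤ K * f s := by
    have hn : ‖v₁ l - v₂ l‖ ≤ C * ‖ι (v₁ s) - ι (v₂ s)‖ := by
      have := hS (v₁ s) (v₂ s)
      rwa [← ht₁ τ hτ s, ← ht₂ τ hτ s, add_comm τ s] at this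
    have hP : P (v₁ l - v₂ l) (v₁ l - v₂ l) ≤ ‖P‖ * (C * ‖ι (v₁ s) - ι (v₂ s)‖) ^ 2 := by
      calc _ ≤ ‖P (v₁ l - v₂ l) (v₁ l - v₂ l)‖ := Real.le_norm_self _
        _ ≤ ‖P‖ * ‖v₁ l - v₂ l‖ * ‖v₁ l - v₂ l‖ := P.le_opNorm₂ _ _
        _ = ‖P‖ * ‖v₁ l - v₂ l‖ ^ 2 := by ring
        _ ≤ _ := by gcongr
    have a1 : Real.exp (2 * ν * l) = Real.exp (2 * ν * τ) * Real.exp (2 * ν * s) := by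
      rw [← Real.exp_add, hl]; congr 1; ring
    calc _ ≤ Real.exp (2 * ν * l) * (‖P‖ * (C * ‖ι (v₁ s) - ι (v₂ s)‖) ^ 2) :=
          mul_le_mul_of_nonneg_left hP (Real.exp_pos _).le
      _ = K * f s := by rw [a1, hK, hf]; ring
  have hKf : K * f s < δ * c := by
    have h1 : (K + 1) * f s < δ * c := by
      rw [lt_div_iff₀ (by positivity)] at hfs
      linarith
    linarith [hf0 s]
  have hδc : δ * c ≤ δ * ∫ x in l..r, f x := mul_le_mul_of_nonneg_left hge hδ.le
  have hfin : Real.exp (2 * ν * r) * P (v₁ r - v₂ r) (v₁ r - v₂ r) < 0 := by linarith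
  by_contra! hcon
  exact absurd hfin (not_lt.2 (mul_nonneg (Real.exp_pos _).le hcon))
end

section
/- Let φ be a semiflow on E satisfying (H1), (H3) and (S), and let 𝔄 denote the amenable set of φ. Then for every t ≥ 0 the map φ^t restricted to 𝔄 is a bijection of 𝔄 onto 𝔄. -/
open Set Filter Topology MeasureTheory Bornology

theorem amenable_shift {E : Type*} [NormedAddCommGroup E] [NormedSpace ℝ E]
    {H : Type*} [NormedAddCommGroup H] [InnerProductSpace ℝ H]
    (ι : E →L[ℝ] H) (φ : Semiflow E) (ν : ℝ) (v : ℝ → E)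
    (hv : φ.IsAmenableTrajectory ι ν v) (a : ℝ) :
    φ.IsAmenableTrajectory ι ν (fun s => v (s + a)) := by
  obtain ⟨⟨hc, hf⟩, hi⟩ := hv
  refine ⟨⟨by fun_prop, fun t ht s => ?_⟩, ?_⟩
  · simp only
    rw [add_assoc]
    exact hf t ht _
  · have hcont : Continuous (fun s : ℝ => Real.exp (2 * ν * s) * ‖ι (v s)‖ ^ 2) := by fun_prop
    have h1 : IntegrableOn (fun s : ℝ => Real.exp (2 * ν * s) * ‖ι (v s)‖ ^ 2) (Set.Iic a) := by
      have h2 : IntegrableOn (fun s : ℝ => Real.exp (2 * ν * s) * ‖ι (v s)‖ ^ 2)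
          (Set.Icc 0 a) := hcont.continuousOn.integrableOn_Icc
      refine (hi.union h2).mono_set ?_
      intro x hx
      by_cases h : x ≤ 0
      · exact Or.inl h
      · exact Or.inr ⟨(not_le.mp h).le, hx⟩
    have h3 := (measurePreserving_add_right volume a).integrableOn_comp_preimage
      (measurableEmbedding_addRight a)
      (f := fun s : ℝ => Real.exp (2 * ν * s) * ‖ι (v s)‖ ^ 2) (s := Set.Iic a)
    have h4 := h3.mpr h1
    have h5 : (fun x => x + a) ⁻¹' (Set.Iic a) = Set.Iic (0 : ℝ) := by
      ext x; simp
    rw [h5] at h4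
    refine (h4.const_mul (Real.exp (-(2 * ν * a)))).congr ?_
    refine Filter.Eventually.of_forall (fun x => ?_)
    simp only [Function.comp]
    rw [← mul_assoc, ← Real.exp_add]
    congr 2
    ring

theorem amenable_inj {E : Type*} [NormedAddCommGroup E] [NormedSpace ℝ E]
    {H : Type*} [NormedAddCommGroup H] [InnerProductSpace ℝ H]
    (ι : E →L[ℝ] H) (hι : Function.Injective ι)
    (φ : Semiflow E) (P : E →L[ℝ] E →L[ℝ] ℝ)
    (δ τV ν : ℝ) (hH3 : φ.IsH3 ι P δ τV ν)
    (hS : φ.IsSmoothing ι) (u v : ℝ → E)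
    (hu : φ.IsAmenableTrajectory ι ν u) (hv : φ.IsAmenableTrajectory ι ν v)
    (t : ℝ) (ht : 0 ≤ t) (huv : u t = v t) : u 0 = v 0 := by
  obtain ⟨⟨huc, huf⟩, hui⟩ := hu
  obtain ⟨⟨hvc, hvf⟩, hvi⟩ := hv
  obtain ⟨hδ, hτV, hν, h3⟩ := hH3
  obtain ⟨τ, C, hτ, hC, hS⟩ := hS
  by_contra hne
  set f : ℝ → ℝ := fun s => Real.exp (2 * ν * s) * ‖ι (u s) - ι (v s)‖ ^ 2 with hf
  have hfc : Continuous f := by fun_prop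
  have hf0 : ∀ s, 0 ≤ f s := fun s => by positivity
  have hfpos : 0 < f 0 := by
    have : 0 < ‖ι (u 0) - ι (v 0)‖ := norm_pos_iff.mpr (sub_ne_zero.mpr (fun h => hne (hι h)))
    positivity
  have hfi : IntegrableOn f (Set.Iic 0) := by
    refine Integrable.mono' ((hui.const_mul 2).add (hvi.const_mul 2))
      hfc.aestronglyMeasurable (Filter.Eventually.of_forall fun s => ?_)
    rw [Real.norm_of_nonneg (hf0 s)]
    simp only [Pi.add_apply, hf]
    have h1 : ‖ι (u s) - ι (v s)‖ ^ 2 ≤ 2 * ‖ι (u s)‖ ^ 2 + 2 * ‖ι (v s)‖ ^ 2 := by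
      have := norm_sub_le (ι (u s)) (ι (v s))
      have h2 := norm_nonneg (ι (u s) - ι (v s))
      nlinarith [sq_nonneg (‖ι (u s)‖ - ‖ι (v s)‖)]
    have := mul_le_mul_of_nonneg_left h1 (Real.exp_pos (2 * ν * s)).le
    linarith
  set c := ∫ s in (-1 : ℝ)..0, f s with hcdef
  have hc : 0 < c := by
    refine intervalIntegral.integral_pos (by norm_num) hfc.continuousOn (fun s _ => hf0 s)
      ⟨0, by simp, hfpos⟩
  -- squeezing
  have key : ∀ l : ℝ, l ≤ -1 - τV →
      δ * c ≤ Real.exp (2 * ν * l) * P (u l - v l) (u l - v l) := by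
    intro l hl
    have h := h3 (u l) (v l) 0 (t - l) le_rfl (by linarith) (by linarith)
    have hint : ∫ s in (0:ℝ)..(t - l), Real.exp (2 * ν * s) *
        ‖ι (φ.toFun s (u l)) - ι (φ.toFun s (v l))‖ ^ 2
        = Real.exp (-(2 * ν * l)) * ∫ s in l..t, f s := by
      have e1 : ∫ s in (0:ℝ)..(t - l), f (s + l) = ∫ s in l..t, f s := by
        rw [intervalIntegral.integral_comp_add_right]; simp
      rw [← e1, ← intervalIntegral.integral_const_mul]
      refine intervalIntegral.integral_congr (fun s hs => ?_)
      rw [Set.uIcc_of_le (by linarith)] at hs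
      simp only [hf]
      rw [huf s hs.1 l, hvf s hs.1 l, ← mul_assoc, ← Real.exp_add]
      congr 2
      ring
    rw [hint, ← huf _ (by linarith), ← hvf _ (by linarith), φ.map_zero', φ.map_zero',
      sub_add_cancel, huv] at h
    simp only [sub_self, map_zero, mul_zero, Real.exp_zero, one_mul, zero_sub] at h
    have hm : c ≤ ∫ s in l..t, f s := by
      refine intervalIntegral.integral_mono_interval (by linarith) (by norm_num) ht
        (Filter.Eventually.of_forall hf0) (hfc.intervalIntegrable _ _)
    have h4 : δ * (Real.exp (-(2 * ν * l)) * ∫ s in l..t, f s) ≤ P (u l - v l) (u l - v l) := by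
      linarith
    have h5 := mul_le_mul_of_nonneg_left h4 (Real.exp_pos (2 * ν * l)).le
    have h6 : Real.exp (2 * ν * l) * Real.exp (-(2 * ν * l)) = 1 := by
      rw [← Real.exp_add]; simp
    calc δ * c ≤ δ * ∫ s in l..t, f s := mul_le_mul_of_nonneg_left hm hδ.le
      _ = (Real.exp (2 * ν * l) * Real.exp (-(2 * ν * l))) * (δ * ∫ s in l..t, f s) := by
        rw [h6, one_mul]
      _ = Real.exp (2 * ν * l) * (δ * (Real.exp (-(2 * ν * l)) * ∫ s in l..t, f s)) := by ring
      _ ≤ _ := h5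
  have key2 : ∀ s : ℝ, s ≤ -1 - τV - τ →
      δ * c ≤ (‖P‖ * C ^ 2 * Real.exp (2 * ν * τ)) * f s := by
    intro s hs
    have h := key (τ + s) (by linarith)
    have hsm := hS (u s) (v s)
    rw [← huf τ hτ, ← hvf τ hτ] at hsm
    have hP : P (u (τ + s) - v (τ + s)) (u (τ + s) - v (τ + s)) ≤
        ‖P‖ * (C * ‖ι (u s) - ι (v s)‖) ^ 2 := by
      calc _ ≤ ‖P (u (τ + s) - v (τ + s)) (u (τ + s) - v (τ + s))‖ := le_abs_self _
        _ ≤ ‖P‖ * ‖u (τ + s) - v (τ + s)‖ * ‖u (τ + s) - v (τ + s)‖ := P.le_opNorm₂ _ _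
        _ = ‖P‖ * ‖u (τ + s) - v (τ + s)‖ ^ 2 := by ring
        _ ≤ _ := by gcongr
    have h5 := mul_le_mul_of_nonneg_left hP (Real.exp_pos (2 * ν * (τ + s))).le
    have h6 : Real.exp (2 * ν * (τ + s)) = Real.exp (2 * ν * τ) * Real.exp (2 * ν * s) := by
      rw [← Real.exp_add]; congr 1; ring
    calc δ * c ≤ _ := h.trans h5
      _ = _ := by rw [h6]; simp only [hf]; ring
  have hcon : IntegrableOn (fun _ : ℝ => δ * c) (Set.Iic (-1 - τV - τ)) := by
    have hfi' := hfi.mono_set (Set.Iic_subset_Iic.mpr (by linarith : -1 - τV - τ ≤ 0))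
    refine Integrable.mono' (hfi'.const_mul (‖P‖ * C ^ 2 * Real.exp (2 * ν * τ)))
      aestronglyMeasurable_const ?_
    refine (ae_restrict_mem measurableSet_Iic).mono (fun s hs => ?_)
    rw [Real.norm_of_nonneg (by positivity)]
    exact key2 s hs
  rw [integrableOn_const_iff enorm_ne_top] at hcon
  rcases hcon with h | h
  · exact (mul_pos hδ hc).ne' (enorm_eq_zero.mp h)
  · simp at h

/-- Each map `φ^t` (`t ≥ 0`) restricts to a bijection of the amenable set `𝔄` onto itself. -/
theorem bijOn_amenableSet
    {E : Type*} [NormedAddCommGroup E] [NormedSpace ℝ E]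
    {H : Type*} [NormedAddCommGroup H] [InnerProductSpace ℝ H]
    (ι : E →L[ℝ] H) (hι : Function.Injective ι)
    (φ : Semiflow E)
    (P : E →L[ℝ] E →L[ℝ] ℝ) (Eplus Eminus : Submodule ℝ E)
    (hH1 : Semiflow.IsH1 P Eplus Eminus)
    (δ τV ν : ℝ) (hH3 : φ.IsH3 ι P δ τV ν)
    (hS : φ.IsSmoothing ι)
    : ∀ t : ℝ, 0 ≤ t →
      Set.BijOn (φ.toFun t) (φ.amenableSet ι ν) (φ.amenableSet ι ν) := by
  intro t ht
  have traj : ∀ v : ℝ → E, φ.IsAmenableTrajectory ι ν v → φ.toFun t (v 0) = v t := by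
    intro v hv
    have := hv.1.2 t ht 0
    rw [add_zero] at this
    exact this.symm
  refine ⟨?_, ?_, ?_⟩
  · rintro _ ⟨v, hv, rfl⟩
    exact ⟨_, amenable_shift ι φ ν v hv t, by simp only [zero_add]; exact (traj v hv).symm⟩
  · rintro _ ⟨u, hu, rfl⟩ _ ⟨v, hv, rfl⟩ h
    rw [traj u hu, traj v hv] at h
    exact amenable_inj ι hι φ P δ τV ν hH3 hS u v hu hv t ht h
  · rintro _ ⟨v, hv, rfl⟩
    refine ⟨v (0 + -t), ⟨_, amenable_shift ι φ ν v hv (-t), rfl⟩, ?_⟩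
    rw [← hv.1.2 t ht]
    simp
end

section
/- Let φ be a semiflow on E satisfying (H1), (H2), (H3), (COM) and (S), let 𝔄 be its amenable set and Π : E → E⁻ the V-orthogonal projector onto E⁻. Then either 𝔄 = ∅, or the restriction Π : 𝔄 → E⁻ is a homeomorphism of 𝔄 (with the topology induced from E) onto E⁻. -/
open Set Filter Topology MeasureTheory Bornology

theorem aux_det_poly {F : Type*} [NormedAddCommGroup F] [NormedSpace ℝ F] [FiniteDimensional ℝ F]
    (A : F →L[ℝ] F) :
    ∃ q : Polynomial ℝ, q.natDegree ≤ Module.finrank ℝ F ∧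
      ∀ t : ℝ, (ContinuousLinearMap.id ℝ F + t • A).det = q.eval t := by
  classical
  let b := Module.finBasis ℝ F
  let M := LinearMap.toMatrix b b (A : F →ₗ[ℝ] F)
  refine ⟨Matrix.det ((Polynomial.X : Polynomial ℝ) • M.map Polynomial.C +
    (1 : Matrix _ _ ℝ).map Polynomial.C), ?_, ?_⟩
  · simpa using Polynomial.natDegree_det_X_add_C_le M 1
  · intro t
    have h1 : (ContinuousLinearMap.id ℝ F + t • A).det
        = LinearMap.det (LinearMap.id + t • (A : F →ₗ[ℝ] F)) := rfl
    rw [h1, ← LinearMap.det_toMatrix b, ← Polynomial.coe_evalRingHom, RingHom.map_det]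
    congr 1
    ext i j
    simp [M, Matrix.map_apply, Matrix.one_apply]
    split_ifs <;> simp <;> ring

theorem aux_interp (n : ℕ) (s : ℝ) (hs : 0 < s) : ∃ c : ℕ → ℝ,
    ∀ q : Polynomial ℝ, q.natDegree ≤ n →
      q.eval 1 = ∑ i ∈ Finset.range (n+1), c i * q.eval (s / (i + 1)) := by
  classical
  let v : ℕ → ℝ := fun i => s / (i + 1)
  have hv : Set.InjOn v (Finset.range (n+1)) := by
    intro i _ j _ h
    have hi : (0:ℝ) < i + 1 := by positivity
    have hj : (0:ℝ) < j + 1 := by positivity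
    simp only [v] at h
    rw [div_eq_div_iff hi.ne' hj.ne'] at h
    have := mul_left_cancel₀ hs.ne' h
    exact_mod_cast (by linarith : (i:ℝ) = j)
  refine ⟨fun i => (Lagrange.basis (Finset.range (n+1)) v i).eval 1, fun q hq => ?_⟩
  have hd : q.degree < (Finset.range (n+1)).card := by
    rw [Finset.card_range]
    exact lt_of_le_of_lt (Polynomial.degree_le_of_natDegree_le hq) (by exact_mod_cast Nat.lt_succ_self n)
  conv_lhs => rw [Lagrange.eq_interpolate hv hd]
  rw [Lagrange.interpolate_apply, Polynomial.eval_finsetSum]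
  refine Finset.sum_congr rfl fun i _ => ?_
  simp [v, mul_comm]

theorem aux_glue_lipschitz {F : Type*} [NormedAddCommGroup F] [NormedSpace ℝ F]
    (p : F → F) (R : ℝ) (L : NNReal) (hp : LipschitzOnWith L p (Metric.closedBall 0 R))
    (h0 : ∀ x, ‖x‖ = R → p x = 0) :
    LipschitzWith L (fun x => if ‖x‖ ≤ R then p x else 0) := by
  have key : ∀ x y : F, ‖x‖ ≤ R → ¬ ‖y‖ ≤ R → ‖p x‖ ≤ L * ‖x - y‖ := by
    intro x y hx hy
    push Not at hy
    have hc : ContinuousOn (fun t : ℝ => ‖x + t • (y - x)‖) (Icc 0 1) := by fun_prop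
    obtain ⟨t, ht, hte⟩ := intermediate_value_Icc (zero_le_one) hc
      (show R ∈ Icc _ _ by constructor <;> simp [hx, hy.le])
    have := hp.dist_le_mul x (by simpa using hx) (x + t • (y - x)) (by simpa using hte.le)
    rw [h0 _ hte, dist_zero_right, dist_eq_norm] at this
    refine this.trans ?_
    gcongr
    have h2 : x - (x + t • (y - x)) = t • (x - y) := by module
    rw [h2, norm_smul, Real.norm_eq_abs, abs_of_nonneg ht.1]
    exact mul_le_of_le_one_left (norm_nonneg _) ht.2
  refine LipschitzWith.of_dist_le_mul fun x y => ?_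
  rw [dist_eq_norm, dist_eq_norm]
  by_cases hx : ‖x‖ ≤ R <;> by_cases hy : ‖y‖ ≤ R
  · simp only [hx, hy, if_true]
    have := hp.dist_le_mul x (by simpa using hx) y (by simpa using hy)
    simpa [dist_eq_norm] using this
  · simpa [hx, hy] using key x y hx hy
  · simpa [hx, hy, norm_sub_rev] using key y x hy hx
  · simp only [hx, hy, if_false, sub_self, norm_zero]; positivity

theorem aux_image_ball {F : Type*} [NormedAddCommGroup F] [NormedSpace ℝ F] [FiniteDimensional ℝ F]
    (p : F → F) (R : ℝ) (L : NNReal) (hp : LipschitzOnWith L p (Metric.closedBall 0 R))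
    (h0 : ∀ x, ‖x‖ = R → p x = 0) (t : ℝ) (ht : 0 ≤ t) (htL : t * L < 1) :
    InjOn (fun x => x + t • p x) (Metric.closedBall 0 R) ∧
    (fun x => x + t • p x) '' (Metric.closedBall 0 R) = Metric.closedBall 0 R := by
  have hg := aux_glue_lipschitz p R L hp h0
  set g : F → F := fun x => if ‖x‖ ≤ R then p x else 0 with hgdef
  have hap : ApproximatesLinearOn (fun x => x + t • g x)
      ((ContinuousLinearEquiv.refl ℝ F : F ≃L[ℝ] F) : F →L[ℝ] F) univ (Real.toNNReal t * L) := by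
    intro x _ y _
    have := hg.dist_le_mul x y
    rw [dist_eq_norm, dist_eq_norm] at this
    have e : x + t • g x - (y + t • g y) - (((ContinuousLinearEquiv.refl ℝ F : F ≃L[ℝ] F) : F →L[ℝ] F)) (x - y)
        = t • (g x - g y) := by
      simp only [ContinuousLinearEquiv.coe_refl, ContinuousLinearMap.coe_id', id]
      module
    rw [e, norm_smul, Real.norm_eq_abs, abs_of_nonneg ht]
    push_cast
    rw [Real.coe_toNNReal _ ht, mul_assoc]
    gcongr
  have hc : Subsingleton F ∨ (Real.toNNReal t * L) <
      (‖((ContinuousLinearEquiv.refl ℝ F).symm : F →L[ℝ] F)‖₊)⁻¹ := by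
    rcases subsingleton_or_nontrivial F with h | h
    · exact Or.inl h
    · right
      have : ‖((ContinuousLinearEquiv.refl ℝ F).symm : F →L[ℝ] F)‖₊ = 1 := by
        ext; simp
      rw [this, inv_one, ← NNReal.coe_lt_coe]
      push_cast
      rwa [Real.coe_toNNReal _ ht]
  have hinj := hap.injOn hc
  have hsurj := hap.surjective hc
  have heq : ∀ x ∈ Metric.closedBall (0:F) R, x + t • p x = x + t • g x := by
    intro x hx
    have : ‖x‖ ≤ R := by simpa using hx
    simp [hgdef, this]
  have hout : ∀ x, ¬ ‖x‖ ≤ R → x + t • g x = x := by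
    intro x hx; simp [hgdef, hx]
  have hbd : ∀ x, ‖x‖ = R → x + t • g x = x := by
    intro x hx; simp [hgdef, hx, h0 x hx]
  refine ⟨fun x hx y hy h => hinj (mem_univ _) (mem_univ _) ?_, ?_⟩
  · simp only [heq x hx, heq y hy] at h; exact h
  · rw [image_congr heq]
    apply Subset.antisymm
    · rintro _ ⟨x, hx, rfl⟩
      by_contra hcon
      have h1 : ¬ ‖x + t • g x‖ ≤ R := by simpa using hcon
      have := hinj (mem_univ _) (mem_univ x) (hout _ h1)
      have h3 : x + t • g x = x := this
      rw [h3] at h1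
      exact h1 (by simpa using hx)
    · intro y hy
      obtain ⟨x, hx⟩ := hsurj y
      refine ⟨x, ?_, hx⟩
      by_contra hcon
      have h1 : ¬ ‖x‖ ≤ R := by simpa using hcon
      simp only [hout x h1] at hx
      rw [hx] at h1
      exact h1 (by simpa using hy)

theorem aux_no_retraction {F : Type*} [NormedAddCommGroup F] [InnerProductSpace ℝ F]
    [FiniteDimensional ℝ F] (r : F → F) (hr : ContDiff ℝ 1 r) (R : ℝ) (hR : 0 < R)
    (h1 : ∀ x, ‖r x‖ = R) (h2 : ∀ x, ‖x‖ = R → r x = x) : False := by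
  borelize F
  let μ : Measure F := Measure.addHaar
  let B := Metric.closedBall (0:F) R
  have hBc : IsCompact B := isCompact_closedBall 0 R
  let p : F → F := fun x => r x - x
  have hp : ContDiff ℝ 1 p := hr.sub contDiff_id
  have hdc : Continuous (fderiv ℝ p) := hp.continuous_fderiv one_ne_zero
  have hdiff : Differentiable ℝ p := hp.differentiable one_ne_zero
  obtain ⟨M, hM⟩ := hBc.exists_bound_of_continuousOn hdc.continuousOn
  have hMn : 0 ≤ M := (norm_nonneg _).trans (hM 0 (by simp [B, hR.le]))
  have hLip : LipschitzOnWith (Real.toNNReal M) p B := by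
    refine (convex_closedBall 0 R).lipschitzOnWith_of_nnnorm_fderiv_le (𝕜 := ℝ)
      (fun x _ => hdiff x) (fun x hx => ?_)
    rw [← NNReal.coe_le_coe, Real.coe_toNNReal _ hMn]
    exact hM x hx
  have hp0 : ∀ x, ‖x‖ = R → p x = 0 := fun x hx => by simp [p, h2 x hx]
  let Dt : ℝ → F → ℝ := fun t x => (ContinuousLinearMap.id ℝ F + t • fderiv ℝ p x).det
  have hDtc : ∀ t, Continuous (Dt t) := fun t =>
    ContinuousLinearMap.continuous_det.comp (by fun_prop)
  obtain ⟨e, he, hdet⟩ : ∃ e > 0, ∀ A : F →L[ℝ] F, ‖A‖ < e →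
      0 < (ContinuousLinearMap.id ℝ F + A).det := by
    have hc : Continuous fun A : F →L[ℝ] F => (ContinuousLinearMap.id ℝ F + A).det :=
      ContinuousLinearMap.continuous_det.comp (by fun_prop)
    have h01 : (0:ℝ) < (ContinuousLinearMap.id ℝ F + 0).det := by
      simp [ContinuousLinearMap.det]
    have := hc.continuousAt.eventually (lt_mem_nhds h01)
    obtain ⟨e, he, h⟩ := Metric.eventually_nhds_iff.1 this
    exact ⟨e, he, fun A hA => h (by simpa using hA)⟩
  obtain ⟨s, hs, hs1, hs2⟩ : ∃ s > 0, s * M < 1 ∧ s * M < e := by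
    refine ⟨min 1 e / (M + 1) / 2, by positivity, ?_, ?_⟩
    all_goals
      have h3 : min 1 e / (M+1) / 2 * M < min 1 e := by
        rw [div_div, div_mul_eq_mul_div, div_lt_iff₀ (by positivity)]
        have : 0 < min 1 e := by positivity
        nlinarith
    · exact h3.trans_le (min_le_left _ _)
    · exact h3.trans_le (min_le_right _ _)
  have hvol : ∀ t, 0 ≤ t → t ≤ s → ∫ x in B, Dt t x ∂μ = μ.real B := by
    intro t ht hts
    have htM : t * M ≤ s * M := by gcongr
    obtain ⟨hi, him⟩ := aux_image_ball p R _ hLip hp0 t ht (by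
      rw [Real.coe_toNNReal _ hMn]; linarith)
    have hch := integral_image_eq_integral_abs_det_fderiv_smul μ (s := B)
      (f := fun x => x + t • p x)
      (f' := fun x => ContinuousLinearMap.id ℝ F + t • fderiv ℝ p x)
      Metric.isClosed_closedBall.measurableSet
      (fun x _ => ((hasFDerivAt_id x).add ((hdiff x).hasFDerivAt.const_smul t)).hasFDerivWithinAt)
      hi (fun _ => (1:ℝ))
    rw [him] at hch
    simp only [smul_eq_mul, mul_one, integral_const, measureReal_restrict_apply_univ] at hch
    rw [show μ.real B = _ from hch]
    refine setIntegral_congr_fun Metric.isClosed_closedBall.measurableSet fun x hx => ?_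
    have : 0 < Dt t x := by
      apply hdet
      rw [norm_smul, Real.norm_eq_abs, abs_of_nonneg ht]
      calc t * ‖fderiv ℝ p x‖ ≤ t * M := by gcongr; exact hM x hx
        _ < e := by linarith
    exact (abs_of_pos this).symm
  obtain ⟨c, hc⟩ := aux_interp (Module.finrank ℝ F) s hs
  have hD1 : ∀ x, Dt 1 x = ∑ i ∈ Finset.range (Module.finrank ℝ F + 1), c i * Dt (s / (i+1)) x := by
    intro x
    obtain ⟨q, hq, hqe⟩ := aux_det_poly (fderiv ℝ p x)
    simp only [Dt, hqe]
    exact hc q hq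
  have hIntg : ∀ t, IntegrableOn (Dt t) B μ := fun t => (hDtc t).continuousOn.integrableOn_compact hBc
  have hI1 : ∫ x in B, Dt 1 x ∂μ = μ.real B := by
    simp only [hD1]
    rw [integral_finsetSum _ (fun i _ => (hIntg _).const_mul _)]
    simp only [integral_const_mul]
    have := hc 1 (by simp)
    simp only [Polynomial.eval_one, mul_one] at this
    rw [Finset.sum_congr rfl (fun i _ => by rw [hvol (s/(i+1)) (by positivity) (div_le_self hs.le (by
      have : (0:ℝ) ≤ i := by positivity
      linarith))]), ← Finset.sum_mul, ← this, one_mul]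
  have hz : ∀ x, Dt 1 x = 0 := by
    intro x
    have hrd : HasFDerivAt r (ContinuousLinearMap.id ℝ F + (1:ℝ) • fderiv ℝ p x) x := by
      have := (hasFDerivAt_id x).add (hdiff x).hasFDerivAt
      rw [one_smul]
      convert this using 1
      ext y; simp [p]
    by_contra hne
    set A := ContinuousLinearMap.id ℝ F + (1:ℝ) • fderiv ℝ p x with hA
    have hne' : LinearMap.det (A : F →ₗ[ℝ] F) ≠ 0 := hne
    have hsur : Function.Surjective (A : F →ₗ[ℝ] F) :=
      ((LinearMap.isUnit_iff_isUnit_det _).2 (isUnit_iff_ne_zero.2 hne') |>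
        (Module.End.isUnit_iff _).1).2
    obtain ⟨w, hw⟩ := hsur (r x)
    have hn := hrd.norm_sq
    have hconst : (fun y => ‖r y‖^2) = fun _ => R^2 := by ext y; rw [h1]
    rw [hconst] at hn
    have := congrArg (fun T : F →L[ℝ] ℝ => T w) (hn.unique (hasFDerivAt_const _ _))
    have hw' : A w = r x := hw
    simp [hw', h1] at this
    exact hR.ne' this
  have : μ.real B = 0 := by rw [← hI1]; simp [hz]
  have hpos : 0 < μ B := Metric.measure_closedBall_pos μ 0 hR
  have hfin : μ B < ⊤ := hBc.measure_lt_top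
  exact (ENNReal.toReal_pos hpos.ne' hfin.ne).ne' this

theorem aux_zero {F : Type*} [NormedAddCommGroup F] [InnerProductSpace ℝ F]
    [FiniteDimensional ℝ F] (h : F → F) (hc : Continuous h) (h1 : ∀ x, ‖h x - x‖ ≤ 1) :
    ∃ x, h x = 0 := by
  by_contra hne
  push Not at hne
  let χ : F → ℝ := fun x => max 0 (min 1 (3 - ‖x‖))
  have hχc : Continuous χ := by fun_prop
  have hχ0 : ∀ x, 0 ≤ χ x := fun x => le_max_left _ _
  have hχ1 : ∀ x, χ x ≤ 1 := fun x => max_le zero_le_one (min_le_left _ _)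
  let h' : F → F := fun x => x + χ x • (h x - x)
  have h'c : Continuous h' := by fun_prop
  have hpne : ∀ x, h' x ≠ 0 := by
    intro x hx
    have hx' : x = - (χ x • (h x - x)) := eq_neg_of_add_eq_zero_left hx
    have hn : ‖x‖ ≤ 1 := by
      rw [hx', norm_neg, norm_smul, Real.norm_eq_abs, abs_of_nonneg (hχ0 x)]
      calc χ x * ‖h x - x‖ ≤ 1 * 1 := mul_le_mul (hχ1 x) (h1 x) (norm_nonneg _) zero_le_one
        _ = 1 := one_mul 1
    have hχx : χ x = 1 := by
      simp only [χ]
      rw [min_eq_left (by linarith), max_eq_right zero_le_one]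
    apply hne x
    simpa [h', hχx] using hx
  have h'out : ∀ x, 3 < ‖x‖ → h' x = x := by
    intro x hx
    have hχx : χ x = 0 := by
      simp only [χ]
      rw [max_eq_left]
      exact (min_le_right _ _).trans (by linarith)
    simp [h', hχx]
  obtain ⟨g, hg, hgd, hge, -⟩ := h'c.exists_contDiff_approx_and_eqOn (⊤ : ℕ∞)
    (ε := fun x => ‖h' x‖ / 2) (by fun_prop) (fun x => half_pos (norm_pos_iff.2 (hpne x)))
    (S := {x | 4 ≤ ‖x‖}) (U := {x | 3 < ‖x‖}) (isClosed_le continuous_const continuous_norm)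
    ((isOpen_lt continuous_const continuous_norm).mem_nhdsSet.2 (fun x hx => by
      have : (4:ℝ) ≤ ‖x‖ := hx
      show (3:ℝ) < ‖x‖
      linarith))
    (contDiff_id.contDiffOn.congr (fun x hx => h'out x hx))
  have hgne : ∀ x, g x ≠ 0 := by
    intro x hx
    have := hgd x
    rw [hx, dist_zero_left] at this
    linarith [norm_nonneg (h' x)]
  have hg1 : ContDiff ℝ 1 g := hg.of_le (by exact_mod_cast le_top)
  refine aux_no_retraction (fun x => (4 / ‖g x‖) • g x) ?_ 4 (by norm_num) ?_ ?_
  · exact (contDiff_const.div (hg1.norm ℝ hgne) (fun x => norm_ne_zero_iff.2 (hgne x))).smul hg1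
  · intro x
    rw [norm_smul, norm_div, norm_norm, div_mul_cancel₀ _ (norm_ne_zero_iff.2 (hgne x))]
    norm_num
  · intro x hx
    have e : g x = x := by
      rw [hge (show (4:ℝ) ≤ ‖x‖ from hx.ge)]
      exact h'out x (by rw [hx]; norm_num)
    rw [e, hx]; norm_num

theorem aux_interior {F : Type*} [NormedAddCommGroup F] [InnerProductSpace ℝ F]
    [FiniteDimensional ℝ F] (f G : F → F) (hf : Continuous f) (K : NNReal) (hG : LipschitzWith K G)
    (hGf : ∀ x, G (f x) = x) : f 0 ∈ interior (range f) := by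
  by_contra hcon
  obtain ⟨ε, hε, hKε⟩ : ∃ ε > (0:ℝ), K * ε ≤ 1/2 := by
    refine ⟨1 / (2 * (K + 1)), by positivity, ?_⟩
    rw [mul_one_div, div_le_iff₀ (by positivity)]
    have : (0:ℝ) ≤ K := K.2
    linarith
  obtain ⟨c, hc1, hc2⟩ : ∃ c, ‖f 0 - c‖ < ε ∧ c ∉ range f := by
    by_contra hh
    push Not at hh
    apply hcon
    rw [mem_interior_iff_mem_nhds, Metric.mem_nhds_iff]
    refine ⟨ε, hε, fun y hy => hh y ?_⟩
    rw [← dist_eq_norm, dist_comm]; exact hy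
  have hne : ∀ x, 0 < ‖f x - c‖ := fun x =>
    norm_pos_iff.2 (sub_ne_zero.2 fun h => hc2 ⟨x, h⟩)
  obtain ⟨a, ha1, ha2, ha3⟩ : ∃ a : F, ‖a‖ ≤ 1/2 ∧ ‖f a - c‖ < ε ∧ a ∉ G '' Metric.sphere c ε := by
    borelize F
    have hnull : Measure.hausdorffMeasure (X := F) (Module.finrank ℝ F) (G '' Metric.sphere c ε) = 0 := by
      refine le_antisymm ((hG.hausdorffMeasure_image_le (by positivity) _).trans ?_) bot_le
      rw [Measure.addHaar_sphere_of_ne_zero _ _ hε.ne', mul_zero]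
    have hd : Dense (G '' Metric.sphere c ε)ᶜ := by
      rw [← interior_eq_empty_iff_dense_compl]
      exact Measure.interior_eq_empty_of_null hnull
    have ho : ∀ᶠ a in 𝓝 (0:F), ‖a‖ ≤ 1/2 ∧ ‖f a - c‖ < ε := by
      refine Filter.Eventually.and ?_ ?_
      · have : ∀ᶠ a in 𝓝 (0:F), ‖a‖ < 1/2 :=
          continuous_norm.continuousAt.eventually (gt_mem_nhds (by norm_num))
        exact this.mono fun a h => h.le
      · have hcc : Continuous fun a => ‖f a - c‖ := by fun_prop
        exact hcc.continuousAt.eventually (gt_mem_nhds hc1)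
    obtain ⟨a, ha, ha'⟩ := hd.inter_nhds_nonempty ho
    exact ⟨a, ha'.1, ha'.2, ha⟩
  let Φ : F → F := fun x => c + max (ε / ‖f x - c‖) 1 • (f x - c)
  have hΦc : Continuous Φ := by
    have : Continuous fun x => ε / ‖f x - c‖ :=
      continuous_const.div (by fun_prop) fun x => (hne x).ne'
    fun_prop
  have hΦd : ∀ x, ‖Φ x - f x‖ ≤ ε := by
    intro x
    have e : Φ x - f x = (max (ε / ‖f x - c‖) 1 - 1) • (f x - c) := by simp only [Φ]; module
    rw [e, norm_smul, Real.norm_eq_abs, abs_of_nonneg (by linarith [le_max_right (ε / ‖f x - c‖) 1])]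
    rcases le_total (ε / ‖f x - c‖) 1 with h | h
    · rw [max_eq_right h]; simp [hε.le]
    · rw [max_eq_left h, sub_mul, div_mul_cancel₀ _ (hne x).ne']
      linarith [hne x]
  obtain ⟨x, hx⟩ := aux_zero (fun x => G (Φ x) - a) (by
      have := hG.continuous; fun_prop) (by
    intro x
    have h1 := hG.dist_le_mul (Φ x) (f x)
    rw [dist_eq_norm, dist_eq_norm, hGf] at h1
    calc ‖G (Φ x) - a - x‖ = ‖(G (Φ x) - x) - a‖ := by congr 1; abel
      _ ≤ ‖G (Φ x) - x‖ + ‖a‖ := norm_sub_le _ _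
      _ ≤ K * ε + 1/2 := by
        gcongr
        exact h1.trans (by gcongr; exact hΦd x)
      _ ≤ 1 := by linarith)
  have hx' : G (Φ x) = a := sub_eq_zero.1 hx
  rcases le_or_gt ε ‖f x - c‖ with h | h
  · have : Φ x = f x := by
      simp only [Φ]
      rw [max_eq_right ((div_le_one (hne x)).2 h)]; simp
    rw [this, hGf] at hx'
    rw [hx'] at h
    linarith
  · apply ha3
    refine ⟨Φ x, ?_, hx'⟩
    rw [mem_sphere_iff_norm]
    simp only [Φ]
    rw [max_eq_left ((one_le_div (hne x)).2 h.le), add_sub_cancel_left, norm_smul, norm_div,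
      norm_norm, div_mul_cancel₀ _ (hne x).ne', Real.norm_eq_abs, abs_of_pos hε]

theorem aux_surj_euclid {F : Type*} [NormedAddCommGroup F] [InnerProductSpace ℝ F]
    [FiniteDimensional ℝ F] (f : F → F) (hf : Continuous f) (K : NNReal)
    (hK : AntilipschitzWith K f) : Function.Surjective f := by
  have hinj : Function.Injective f := hK.injective
  obtain ⟨G, hG, hGe⟩ := (LipschitzOnWith.extend_finite_dimension (s := range f)
    (f := Function.invFun f) (K := K) (by
      rintro _ ⟨x, rfl⟩ _ ⟨y, rfl⟩
      rw [Function.leftInverse_invFun hinj, Function.leftInverse_invFun hinj]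
      exact hK x y))
  have hGf : ∀ x, G (f x) = x := fun x => by
    rw [← hGe (mem_range_self x), Function.leftInverse_invFun hinj]
  have hopen : IsOpen (range f) := by
    rw [← interior_eq_iff_isOpen]
    refine Subset.antisymm interior_subset ?_
    rintro _ ⟨x, rfl⟩
    have := aux_interior (fun y => f (y + x)) (fun z => G z - x) (by fun_prop) (lipschitzExtensionConstant F * K)
      (show LipschitzWith _ (fun z => G z - x) from LipschitzWith.of_dist_le_mul fun y z => by
        simpa using hG.dist_le_mul y z) (fun y => by simp [hGf])
    have hr : range (fun y => f (y + x)) = range f :=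
      (Equiv.addRight x).surjective.range_comp f
    rw [hr] at this
    simpa using this
  have hclosed : IsClosed (range f) := by
    have : range f = {y | f (G y) = y} := by
      ext y; constructor
      · rintro ⟨x, rfl⟩; simp [hGf]
      · intro h; exact ⟨G y, h⟩
    rw [this]
    exact isClosed_eq (hf.comp hG.continuous) continuous_id
  exact range_eq_univ.1 (IsClopen.eq_univ ⟨hclosed, hopen⟩ (range_nonempty f))

theorem aux_surj {F : Type*} [NormedAddCommGroup F] [NormedSpace ℝ F]
    [FiniteDimensional ℝ F] (f : F → F) (hf : Continuous f) (c : ℝ) (hc : 0 < c)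
    (hK : ∀ x y, c * ‖x - y‖ ≤ ‖f x - f y‖) : Function.Surjective f := by
  let e : F ≃L[ℝ] EuclideanSpace ℝ (Fin (Module.finrank ℝ F)) := toEuclidean
  have hKf : AntilipschitzWith (Real.toNNReal c⁻¹) f := AntilipschitzWith.of_le_mul_dist fun x y => by
    rw [Real.coe_toNNReal _ (by positivity), dist_eq_norm, dist_eq_norm, inv_mul_eq_div,
      le_div_iff₀' hc]
    exact hK x y
  have h1 := (e.antilipschitz.comp (hKf.comp e.symm.antilipschitz))
  have := aux_surj_euclid (e ∘ f ∘ e.symm) (by fun_prop) _ h1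
  have h2 : f = e.symm ∘ (e ∘ f ∘ e.symm) ∘ e := by ext x; simp
  rw [h2]
  exact e.symm.surjective.comp (this.comp e.surjective)

theorem aux_mean (g : ℝ → ℝ) (a A : ℝ) (hg : ContinuousOn g (Icc a (a+1)))
    (hA : ∫ s in a..(a+1), g s ≤ A) : ∃ s ∈ Icc a (a+1), g s ≤ A := by
  by_contra hcon
  push Not at hcon
  have := intervalIntegral.integral_lt_integral_of_continuousOn_of_le_of_exists_lt
    (f := fun _ => A) (g := g) (show a < a + 1 by linarith) continuousOn_const hg
    (fun x hx => (hcon x (Ioc_subset_Icc_self hx)).le)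
    ⟨a, left_mem_Icc.2 (by linarith), hcon a (left_mem_Icc.2 (by linarith))⟩
  simp at this
  linarith

theorem aux_small (g : ℝ → ℝ) (hg : IntegrableOn g (Iic 0)) (ε : ℝ) (hε : 0 < ε) (a : ℝ) :
    ∃ s ≤ a, g s < ε := by
  by_contra hcon
  push Not at hcon
  have h1 : IntegrableOn g (Iic (min a 0)) := hg.mono_set (Iic_subset_Iic.2 (min_le_right _ _))
  have h2 : IntegrableOn (fun _ : ℝ => ε) (Iic (min a 0)) := by
    refine h1.mono' aestronglyMeasurable_const ?_
    refine (ae_restrict_iff' measurableSet_Iic).2 (Eventually.of_forall fun s hs => ?_)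
    rw [Real.norm_eq_abs, abs_of_pos hε]
    exact hcon s (le_trans hs (min_le_left _ _))
  rw [integrableOn_const_iff] at h2
  simp [hε.ne'] at h2

section
variable {E : Type*} [NormedAddCommGroup E] [NormedSpace ℝ E]

theorem aux_ker_pos (P : E →L[ℝ] E →L[ℝ] ℝ) (Eplus Eminus : Submodule ℝ E)
    (hH1 : Semiflow.IsH1 P Eplus Eminus) (v : E) (hv : ∀ w ∈ Eminus, P w v = 0) (hne : v ≠ 0) :
    0 < P v v := by
  obtain ⟨hsym, -, -, hcompl, hpos, hneg⟩ := hH1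
  obtain ⟨a, ha, b, hb, rfl⟩ := Submodule.mem_sup.1 (hcompl.sup_eq_top ▸ Submodule.mem_top (x := v))
  have h1 := hv b hb
  simp only [map_add, add_apply] at h1 ⊢
  have h2 := hsym a b
  by_cases ha0 : a = 0
  · have hb0 : b ≠ 0 := by rintro rfl; simp [ha0] at hne
    have := hneg b hb hb0
    subst ha0; simp at *; linarith
  · have h3 := hpos a ha ha0
    have h4 : P b b ≤ 0 := by
      by_cases hb0 : b = 0
      · simp [hb0]
      · exact (hneg b hb hb0).le
    linarith

theorem aux_coercive (P : E →L[ℝ] E →L[ℝ] ℝ) (Eplus Eminus : Submodule ℝ E)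
    [FiniteDimensional ℝ ↥Eminus]
    (hH1 : Semiflow.IsH1 P Eplus Eminus) :
    ∃ c > 0, ∀ w ∈ Eminus, c * ‖w‖ ^ 2 ≤ - P w w := by
  obtain ⟨hsym, -, -, hcompl, hpos, hneg⟩ := hH1
  have hcomp : IsCompact (Metric.sphere (0 : Eminus) 1) := isCompact_sphere 0 1
  have hcont : Continuous fun w : Eminus => - P (w : E) (w : E) := by fun_prop
  rcases (Metric.sphere (0 : Eminus) 1).eq_empty_or_nonempty with he | hn
  · refine ⟨1, one_pos, fun w hw => ?_⟩
    by_cases h0 : w = 0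
    · simp [h0]
    · exfalso
      have : (‖w‖⁻¹ • (⟨w, hw⟩ : Eminus)) ∈ Metric.sphere (0 : Eminus) 1 := by
        simp [norm_smul, h0]
      rw [he] at this
      exact this
  · obtain ⟨x, hx, hmin⟩ := hcomp.exists_isMinOn hn hcont.continuousOn
    have hx1 : ‖x‖ = 1 := by simpa using hx
    refine ⟨- P (x : E) (x : E), ?_, fun w hw => ?_⟩
    · have : (x : E) ≠ 0 := by
        intro h
        have : x = 0 := Subtype.ext h
        simp [this] at hx1
      linarith [hneg x x.2 this]
    · by_cases h0 : w = 0
      · simp [h0]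
      · have hs : (‖w‖⁻¹ • (⟨w, hw⟩ : Eminus)) ∈ Metric.sphere (0 : Eminus) 1 := by
          simp [norm_smul, h0]
        have := hmin hs
        simp only [mem_ofPred_eq, Submodule.coe_smul, map_smul, smul_apply, smul_eq_mul] at this
        have hw0 : 0 < ‖w‖ := norm_pos_iff.2 h0
        have e : -(‖w‖⁻¹ * (‖w‖⁻¹ * P w w)) * ‖w‖^2 = - P w w := by field_simp
        rw [← e]
        gcongr

structure AuxProj (P : E →L[ℝ] E →L[ℝ] ℝ) (Eminus : Submodule ℝ E) (Pi : E → E) : Prop where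
  mem : ∀ v, Pi v ∈ Eminus
  sub : ∀ v w, Pi (v - w) = Pi v - Pi w
  cont : Continuous Pi
  le : ∀ v, P (Pi v) (Pi v) ≤ P v v
  eq_zero : ∀ v, Pi v = 0 → P v v ≤ 0 → v = 0

theorem aux_proj (P : E →L[ℝ] E →L[ℝ] ℝ) (Eplus Eminus : Submodule ℝ E)
    [FiniteDimensional ℝ ↥Eminus]
    (hH1 : Semiflow.IsH1 P Eplus Eminus) (Pi : E → E) (hPi : Semiflow.IsVProjector P Eminus Pi) :
    AuxProj P Eminus Pi := by
  have hsub : ∀ v w, Pi (v - w) = Pi v - Pi w := by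
    intro v w
    set z := Pi (v - w) - (Pi v - Pi w) with hz
    have hzm : z ∈ Eminus := Eminus.sub_mem (hPi _).1 (Eminus.sub_mem (hPi _).1 (hPi _).1)
    have hz0 : P z z = 0 := by
      conv_lhs => rw [hz]
      rw [← hz, hz, map_sub, map_sub (P z), ← hz, ← (hPi (v - w)).2 z hzm, ← (hPi v).2 z hzm,
        ← (hPi w).2 z hzm]
      simp
    have : z = 0 := by
      by_contra h
      linarith [hH1.2.2.2.2.2 z hzm h]
    rwa [hz, sub_eq_zero] at this
  have hker : ∀ v, ∀ w ∈ Eminus, P w (v - Pi v) = 0 := by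
    intro v w hw
    rw [map_sub, (hPi v).2 w hw, sub_self]
  have hsplit : ∀ v, P v v = P (Pi v) (Pi v) + P (v - Pi v) (v - Pi v) := by
    intro v
    have h1 := hker v (Pi v) (hPi v).1
    have h2 := hH1.1 v (Pi v)
    simp only [map_sub, sub_apply] at h1 ⊢
    linarith
  obtain ⟨c, hc, hcoer⟩ := aux_coercive P Eplus Eminus hH1
  refine ⟨fun v => (hPi v).1, hsub, ?_, ?_, ?_⟩
  · have hb : ∀ v, ‖Pi v‖ ≤ ‖P‖ / c * ‖v‖ := by
      intro v
      by_cases h0 : Pi v = 0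
      · rw [h0, norm_zero]; positivity
      have h1 := hcoer _ (hPi v).1
      have h2 : - P (Pi v) (Pi v) ≤ ‖P‖ * ‖Pi v‖ * ‖v‖ := by
        rw [← (hPi v).2 _ (hPi v).1]
        exact (neg_le_abs _).trans ((P (Pi v)).le_of_opNorm_le (P.le_opNorm _) v)
      have hp : 0 < ‖Pi v‖ := norm_pos_iff.2 h0
      rw [div_mul_eq_mul_div, le_div_iff₀ hc]
      have h3 : (‖Pi v‖ * c) * ‖Pi v‖ ≤ (‖P‖ * ‖v‖) * ‖Pi v‖ := by nlinarith
      exact le_of_mul_le_mul_right h3 hp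
    have : LipschitzWith (Real.toNNReal (‖P‖ / c)) Pi := LipschitzWith.of_dist_le_mul fun v w => by
      rw [dist_eq_norm, dist_eq_norm, ← hsub, Real.coe_toNNReal _ (by positivity)]
      exact hb _
    exact this.continuous
  · intro v
    rw [hsplit v]
    by_cases h0 : v - Pi v = 0
    · simp [h0]
    · linarith [aux_ker_pos P Eplus Eminus hH1 _ (hker v) h0]
  · intro v h0 hle
    by_contra hne
    have := aux_ker_pos P Eplus Eminus hH1 v (fun w hw => by simpa [h0] using hker v w hw) hne
    linarith

variable {H : Type*} [NormedAddCommGroup H] [InnerProductSpace ℝ H]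

theorem aux_H3traj (φ : Semiflow E) (ι : E →L[ℝ] H) (P : E →L[ℝ] E →L[ℝ] ℝ) (δ τV ν : ℝ)
    (hH3 : φ.IsH3 ι P δ τV ν) (u₁ u₂ : ℝ → E) (l r : ℝ) (hlr : l ≤ r) (hτ : τV ≤ r - l)
    (h1 : ∀ s, l ≤ s → u₁ s = φ.toFun (s - l) (u₁ l))
    (h2 : ∀ s, l ≤ s → u₂ s = φ.toFun (s - l) (u₂ l)) :
    Real.exp (2 * ν * r) * P (u₁ r - u₂ r) (u₁ r - u₂ r) +
      δ * ∫ s in l..r, Real.exp (2 * ν * s) * ‖ι (u₁ s) - ι (u₂ s)‖ ^ 2 ≤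
      Real.exp (2 * ν * l) * P (u₁ l - u₂ l) (u₁ l - u₂ l) := by
  have h := hH3.2.2.2 (u₁ l) (u₂ l) 0 (r - l) le_rfl (by linarith) (by linarith)
  have hIntg : ∫ s in l..r, Real.exp (2 * ν * s) * ‖ι (u₁ s) - ι (u₂ s)‖ ^ 2 =
      Real.exp (2 * ν * l) * ∫ s in (0:ℝ)..(r-l), Real.exp (2 * ν * s) *
        ‖ι (φ.toFun s (u₁ l)) - ι (φ.toFun s (u₂ l))‖ ^ 2 := by
    have := intervalIntegral.integral_comp_sub_right (a := l) (b := r) (fun s => Real.exp (2 * ν * s) *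
        ‖ι (φ.toFun s (u₁ l)) - ι (φ.toFun s (u₂ l))‖ ^ 2) l
    rw [sub_self] at this
    rw [← this, ← intervalIntegral.integral_const_mul]
    refine intervalIntegral.integral_congr fun s hs => ?_
    rw [uIcc_of_le hlr] at hs
    rw [h1 s hs.1, h2 s hs.1, ← mul_assoc, ← Real.exp_add]
    congr 2; ring
  rw [hIntg, h1 r hlr, h2 r hlr]
  have he : Real.exp (2 * ν * r) = Real.exp (2 * ν * l) * Real.exp (2 * ν * (r - l)) := by
    rw [← Real.exp_add]; congr 1; ring
  simp only [φ.map_zero', mul_zero, Real.exp_zero, one_mul] at h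
  rw [he]
  have hp := Real.exp_pos (2 * ν * l)
  have := mul_le_mul_of_nonneg_left h hp.le
  linarith

theorem aux_complete (φ : Semiflow E) (v : ℝ → E) (hv : φ.IsCompleteTrajectory v) (l s : ℝ)
    (h : l ≤ s) : v s = φ.toFun (s - l) (v l) := by
  rw [← hv.2 (s - l) (by linarith) l]; congr 1; ring

theorem aux_pair (φ : Semiflow E) (ι : E →L[ℝ] H) (P : E →L[ℝ] E →L[ℝ] ℝ) (δ τV ν : ℝ)
    (hH3 : φ.IsH3 ι P δ τV ν) (hS : φ.IsSmoothing ι) (u₁ u₂ : ℝ → E)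
    (h1 : φ.IsAmenableTrajectory ι ν u₁) (h2 : φ.IsAmenableTrajectory ι ν u₂) (l : ℝ) (hl : l ≤ 0) :
    P (u₁ 0 - u₂ 0) (u₁ 0 - u₂ 0) +
      δ * ∫ s in l..0, Real.exp (2 * ν * s) * ‖ι (u₁ s) - ι (u₂ s)‖ ^ 2 ≤ 0 := by
  obtain ⟨τ, C, hτ, hC, hSm⟩ := hS
  set g : ℝ → ℝ := fun s => Real.exp (2 * ν * s) * ‖ι (u₁ s) - ι (u₂ s)‖ ^ 2 with hg
  have hc1 := h1.1.1
  have hc2 := h2.1.1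
  have hgc : Continuous g := by fun_prop
  have hg0 : ∀ s, 0 ≤ g s := fun s => by positivity
  have hgi : IntegrableOn g (Iic 0) := by
    refine ((h1.2.add h2.2).const_mul 2).mono' hgc.aestronglyMeasurable (Eventually.of_forall fun s => ?_)
    rw [Real.norm_eq_abs, abs_of_nonneg (hg0 s)]
    have hn : ‖ι (u₁ s) - ι (u₂ s)‖ ^ 2 ≤ 2 * (‖ι (u₁ s)‖ ^ 2 + ‖ι (u₂ s)‖ ^ 2) := by
      have := norm_sub_le (ι (u₁ s)) (ι (u₂ s))
      nlinarith [sq_nonneg (‖ι (u₁ s)‖ - ‖ι (u₂ s)‖), norm_nonneg (ι (u₁ s) - ι (u₂ s))]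
    have := mul_le_mul_of_nonneg_left hn (Real.exp_pos (2 * ν * s)).le
    simp only [hg, Pi.add_apply]
    linarith
  refine le_of_forall_pos_le_add fun ε hε => ?_
  rw [zero_add]
  let D := (‖P‖ + 1) * (Real.exp (2 * ν * τ) * C ^ 2)
  have hD : 0 < D := by positivity
  obtain ⟨s, hs, hgs⟩ := aux_small g hgi (ε / D) (by positivity) (min l (-τV) - τ)
  set q := s + τ with hq
  have hq1 : q ≤ l := by linarith [min_le_left l (-τV)]
  have hq2 : q ≤ -τV := by linarith [min_le_right l (-τV)]
  have hH := aux_H3traj φ ι P δ τV ν hH3 u₁ u₂ q 0 (by linarith) (by linarith)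
    (aux_complete φ u₁ h1.1 q) (aux_complete φ u₂ h2.1 q)
  simp only [mul_zero, Real.exp_zero, one_mul] at hH
  have hmono : ∫ s in l..0, g s ≤ ∫ s in q..0, g s := by
    rw [← intervalIntegral.integral_add_adjacent_intervals (hgc.intervalIntegrable q l)
      (hgc.intervalIntegrable l 0)]
    linarith [intervalIntegral.integral_nonneg (μ := volume) hq1 (fun s _ => hg0 s)]
  have hmono' := mul_le_mul_of_nonneg_left hmono hH3.1.le
  have hsm : ‖u₁ q - u₂ q‖ ≤ C * ‖ι (u₁ s) - ι (u₂ s)‖ := by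
    rw [hq, add_comm, h1.1.2 τ hτ, h2.1.2 τ hτ]; exact hSm _ _
  have hPb : P (u₁ q - u₂ q) (u₁ q - u₂ q) ≤ (‖P‖ + 1) * (C ^ 2 * ‖ι (u₁ s) - ι (u₂ s)‖ ^ 2) := by
    calc P (u₁ q - u₂ q) (u₁ q - u₂ q) ≤ ‖P‖ * ‖u₁ q - u₂ q‖ * ‖u₁ q - u₂ q‖ :=
          (le_abs_self _).trans (P.le_opNorm₂ _ _)
      _ ≤ (‖P‖ + 1) * ‖u₁ q - u₂ q‖ * ‖u₁ q - u₂ q‖ := by gcongr; linarith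
      _ ≤ (‖P‖ + 1) * (C * ‖ι (u₁ s) - ι (u₂ s)‖) * (C * ‖ι (u₁ s) - ι (u₂ s)‖) := by gcongr
      _ = _ := by ring
  have hfin : Real.exp (2 * ν * q) * P (u₁ q - u₂ q) (u₁ q - u₂ q) ≤ ε := by
    calc _ ≤ Real.exp (2 * ν * q) * ((‖P‖ + 1) * (C ^ 2 * ‖ι (u₁ s) - ι (u₂ s)‖ ^ 2)) := by gcongr
      _ = D * g s := by
        have : Real.exp (2 * ν * q) = Real.exp (2 * ν * τ) * Real.exp (2 * ν * s) := by
          rw [← Real.exp_add, hq]; congr 1; ring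
        simp only [D, hg]; rw [this]; ring
      _ ≤ D * (ε / D) := by gcongr
      _ = ε := by field_simp
  linarith

end

section
variable {E : Type*} [NormedAddCommGroup E] [NormedSpace ℝ E]
variable {H : Type*} [NormedAddCommGroup H] [InnerProductSpace ℝ H]

theorem aux_tendsto (φ : Semiflow E) {α : Type*} {F : Filter α} {t : α → ℝ} {t0 : ℝ} {x : α → E}
    {x0 : E} (ht : Tendsto t F (𝓝 t0)) (hpos : ∀ᶠ i in F, 0 ≤ t i) (h0 : 0 ≤ t0)
    (hx : Tendsto x F (𝓝 x0)) :
    Tendsto (fun i => φ.toFun (t i) (x i)) F (𝓝 (φ.toFun t0 x0)) := by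
  have h := φ.continuousOn' (t0, x0) ⟨h0, mem_univ _⟩
  have h2 : Tendsto (fun i => (t i, x i)) F (𝓝[Ici (0:ℝ) ×ˢ univ] (t0, x0)) :=
    tendsto_nhdsWithin_iff.2 ⟨ht.prodMk_nhds hx, hpos.mono fun i hi => ⟨hi, mem_univ _⟩⟩
  exact h.tendsto.comp h2

theorem aux_traj_mid (φ : Semiflow E) (u : ℝ → E) (l : ℝ)
    (h : ∀ s, l ≤ s → u s = φ.toFun (s - l) (u l)) (a : ℝ) (ha : l ≤ a) :
    ∀ s, a ≤ s → u s = φ.toFun (s - a) (u a) := by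
  intro s hs
  rw [h s (ha.trans hs), h a ha, ← φ.map_add' _ _ (by linarith) (by linarith)]
  congr 1; ring

theorem aux_traj_cont (φ : Semiflow E) (u : ℝ → E) (l : ℝ)
    (h : ∀ s, l ≤ s → u s = φ.toFun (s - l) (u l)) : ContinuousOn u (Ici l) := by
  intro t ht
  have h1 : Tendsto (fun s => φ.toFun (s - l) (u l)) (𝓝[Ici l] t) (𝓝 (φ.toFun (t - l) (u l))) := by
    refine aux_tendsto φ ?_ ?_ (sub_nonneg.2 ht) tendsto_const_nhds
    · exact ((continuous_id.sub continuous_const).tendsto t).mono_left nhdsWithin_le_nhds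
    · filter_upwards [self_mem_nhdsWithin] with s hs using sub_nonneg.2 hs
  rw [← h t ht] at h1
  exact h1.congr' (by filter_upwards [self_mem_nhdsWithin] with s hs using (h s hs).symm)

theorem aux_smooth (φ : Semiflow E) (ι : E →L[ℝ] H) (ν τ C : ℝ) (hν : 0 < ν) (hτ : 0 ≤ τ)
    (hC : 0 < C)
    (hSm : ∀ v₁ v₂ : E, ‖φ.toFun τ v₁ - φ.toFun τ v₂‖ ≤ C * ‖ι v₁ - ι v₂‖)
    (u₁ u₂ : ℝ → E) (l : ℝ)
    (h1 : ∀ s, l ≤ s → u₁ s = φ.toFun (s - l) (u₁ l))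
    (h2 : ∀ s, l ≤ s → u₂ s = φ.toFun (s - l) (u₂ l)) (a A : ℝ) (hla : l ≤ a) (ha : a + 1 ≤ 0)
    (hA : ∫ s in l..0, Real.exp (2 * ν * s) * ‖ι (u₁ s) - ι (u₂ s)‖ ^ 2 ≤ A) :
    ∃ s ∈ Icc a (a + 1), ‖u₁ (s + τ) - u₂ (s + τ)‖ ^ 2 ≤ C ^ 2 * (Real.exp (-(2 * ν * a)) * A) := by
  set g : ℝ → ℝ := fun s => Real.exp (2 * ν * s) * ‖ι (u₁ s) - ι (u₂ s)‖ ^ 2 with hg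
  have c1 := aux_traj_cont φ u₁ l h1
  have c2 := aux_traj_cont φ u₂ l h2
  have hgc : ContinuousOn g (Ici l) := by
    have e1 : ContinuousOn (fun s => ι (u₁ s)) (Ici l) := ι.continuous.comp_continuousOn c1
    have e2 : ContinuousOn (fun s => ι (u₂ s)) (Ici l) := ι.continuous.comp_continuousOn c2
    have e3 : Continuous fun s : ℝ => Real.exp (2 * ν * s) := by fun_prop
    exact e3.continuousOn.mul ((e1.sub e2).norm.pow 2)
  have hg0 : ∀ s, 0 ≤ g s := fun s => by positivity
  have hii : ∀ p q, l ≤ p → p ≤ q → IntervalIntegrable g volume p q := fun p q hp hq =>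
    (hgc.mono (by rw [uIcc_of_le hq]; exact fun x hx => hp.trans hx.1)).intervalIntegrable
  have hsum : ∫ s in a..(a+1), g s ≤ A := by
    refine le_trans ?_ hA
    rw [← intervalIntegral.integral_add_adjacent_intervals (hii l a le_rfl hla)
      (hii a 0 hla (by linarith)), ← intervalIntegral.integral_add_adjacent_intervals
      (hii a (a+1) hla (by linarith)) (hii (a+1) 0 (by linarith) ha)]
    have i1 := intervalIntegral.integral_nonneg (μ := volume) hla (fun s _ => hg0 s)
    have i2 := intervalIntegral.integral_nonneg (μ := volume) ha (fun s _ => hg0 s)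
    linarith
  obtain ⟨s, hs, hgs⟩ := aux_mean g a A (hgc.mono fun x hx => hla.trans hx.1) hsum
  refine ⟨s, hs, ?_⟩
  have hls := hla.trans hs.1
  have hA0 : 0 ≤ A := (hg0 s).trans hgs
  have k1 : u₁ (s + τ) = φ.toFun τ (u₁ s) := by
    rw [aux_traj_mid φ u₁ l h1 s hls (s + τ) (by linarith)]; simp
  have k2 : u₂ (s + τ) = φ.toFun τ (u₂ s) := by
    rw [aux_traj_mid φ u₂ l h2 s hls (s + τ) (by linarith)]; simp
  rw [k1, k2]
  have hn : ‖ι (u₁ s) - ι (u₂ s)‖ ^ 2 ≤ Real.exp (-(2 * ν * a)) * A := by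
    have : ‖ι (u₁ s) - ι (u₂ s)‖ ^ 2 = Real.exp (-(2 * ν * s)) * g s := by
      simp only [hg]; rw [← mul_assoc, ← Real.exp_add]; simp
    rw [this]
    have := hs.1
    gcongr
  calc _ ≤ (C * ‖ι (u₁ s) - ι (u₂ s)‖) ^ 2 := by gcongr; exact hSm _ _
    _ = C ^ 2 * ‖ι (u₁ s) - ι (u₂ s)‖ ^ 2 := by ring
    _ ≤ _ := by gcongr

theorem aux_inv_cont (φ : Semiflow E) (ι : E →L[ℝ] H) (P : E →L[ℝ] E →L[ℝ] ℝ)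
    (Eminus : Submodule ℝ E) (Pi : E → E) (hp : AuxProj P Eminus Pi) (δ τV ν : ℝ)
    (hH3 : φ.IsH3 ι P δ τV ν) (hS : φ.IsSmoothing ι) {α : Type*} (F : Ultrafilter α)
    (U : α → ℝ → E) (u : ℝ → E) (hU : ∀ i, φ.IsAmenableTrajectory ι ν (U i))
    (hu : φ.IsAmenableTrajectory ι ν u)
    (hlim : Tendsto (fun i => Pi (U i 0)) F (𝓝 (Pi (u 0)))) :
    Tendsto (fun i => U i 0) F (𝓝 (u 0)) := by
  have hS2 := hS
  obtain ⟨τ, C, hτ, hC, hSm⟩ := hS2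
  have hδ := hH3.1
  have hν := hH3.2.2.1
  have key : ∀ i, ∃ s ∈ Icc (-τ-1) (-τ-1+1), ‖U i (s + τ) - u (s + τ)‖ ^ 2 ≤
      C ^ 2 * (Real.exp (-(2 * ν * (-τ-1))) * (‖P‖ * ‖Pi (U i 0) - Pi (u 0)‖ ^ 2 / δ)) := by
    intro i
    refine aux_smooth φ ι ν τ C hν hτ hC hSm (U i) u (-τ-1) (aux_complete φ _ (hU i).1 _)
      (aux_complete φ _ hu.1 _) (-τ-1) _ le_rfl (by linarith) ?_
    have h := aux_pair φ ι P δ τV ν hH3 hS (U i) u (hU i) hu (-τ-1) (by linarith)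
    have h2 := hp.le (U i 0 - u 0)
    rw [hp.sub] at h2
    have h3 := (neg_le_abs _).trans (P.le_opNorm₂ (Pi (U i 0) - Pi (u 0)) (Pi (U i 0) - Pi (u 0)))
    rw [le_div_iff₀ hδ]
    linarith
  choose s hs hb using key
  have hn : Tendsto (fun i => ‖Pi (U i 0) - Pi (u 0)‖) F (𝓝 0) := by
    simpa using (hlim.sub (tendsto_const_nhds (x := Pi (u 0)))).norm
  have hd2 : Tendsto (fun i => ‖U i (s i + τ) - u (s i + τ)‖ ^ 2) F (𝓝 0) := by
    refine squeeze_zero (fun i => by positivity) hb ?_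
    have := ((((hn.pow 2).const_mul ‖P‖).div_const δ).const_mul
      (Real.exp (-(2 * ν * (-τ-1))))).const_mul (C ^ 2)
    simpa using this
  have hd : Tendsto (fun i => U i (s i + τ) - u (s i + τ)) F (𝓝 0) := by
    rw [tendsto_zero_iff_norm_tendsto_zero]
    have := hd2.sqrt
    simpa [Real.sqrt_sq] using this
  obtain ⟨b, hbm, hbl⟩ : ∃ b ∈ Icc (-1:ℝ) 0, Tendsto (fun i => s i + τ) F (𝓝 b) := by
    have hK : IsCompact (Icc (-1:ℝ) 0) := isCompact_Icc
    have := hK.ultrafilter_le_nhds (F.map fun i => s i + τ) (by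
      rw [le_principal_iff]
      refine Filter.mem_map.2 (Filter.univ_mem' fun i => ?_)
      have := hs i
      exact ⟨by simp only; linarith [this.1], by simp only; linarith [this.2]⟩)
    simpa [Tendsto] using this
  have hub : Tendsto (fun i => u (s i + τ)) F (𝓝 (u b)) := (hu.1.1.tendsto b).comp hbl
  have hUb : Tendsto (fun i => U i (s i + τ)) F (𝓝 (u b)) := by
    simpa using hd.add hub
  have hfin := aux_tendsto φ (t := fun i => 0 - (s i + τ)) (t0 := 0 - b)
    (tendsto_const_nhds.sub hbl) (Eventually.of_forall fun i => by linarith [(hs i).2])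
    (by linarith [hbm.2]) hUb
  rw [← aux_complete φ u hu.1 b 0 hbm.2] at hfin
  refine hfin.congr fun i => ?_
  rw [← aux_complete φ (U i) (hU i).1 (s i + τ) 0 (by linarith [(hs i).2])]

theorem aux_shoot (φ : Semiflow E) (ι : E →L[ℝ] H) (P : E →L[ℝ] E →L[ℝ] ℝ)
    (Eplus Eminus : Submodule ℝ E) [FiniteDimensional ℝ ↥Eminus] (hH1 : Semiflow.IsH1 P Eplus Eminus)
    (Pi : E → E) (hp : AuxProj P Eminus Pi) (δ τV ν : ℝ)
    (hH3 : φ.IsH3 ι P δ τV ν) (k : ℝ) (hk0 : 0 ≤ k) (hk : τV ≤ k) (x ζ : E) (hζ : ζ ∈ Eminus) :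
    ∃ η ∈ Eminus, Pi (φ.toFun k (x + η)) = ζ := by
  obtain ⟨c, hc, hcoer⟩ := aux_coercive P Eplus Eminus hH1
  let f : Eminus → Eminus := fun η => ⟨Pi (φ.toFun k (x + η)), hp.mem _⟩
  have hcont : Continuous f := by
    refine Continuous.subtype_mk (hp.cont.comp ?_) _
    rw [continuous_iff_continuousAt]
    intro η
    exact aux_tendsto φ tendsto_const_nhds (Eventually.of_forall fun _ => hk0) hk0
      ((continuous_const.add continuous_subtype_val).tendsto η)
  let q := c * Real.exp (-(2 * ν * k)) / (‖P‖ + 1)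
  have hq : 0 < q := by positivity
  have hexp : ∀ η₁ η₂ : Eminus, Real.sqrt q * ‖η₁ - η₂‖ ≤ ‖f η₁ - f η₂‖ := by
    intro η₁ η₂
    have h := hH3.2.2.2 (x + η₁) (x + η₂) 0 k le_rfl hk0 (by linarith)
    have hI := intervalIntegral.integral_nonneg (μ := volume) hk0 (fun s _ =>
      (by positivity : 0 ≤ Real.exp (2 * ν * s) *
        ‖ι (φ.toFun s (x + η₁)) - ι (φ.toFun s (x + η₂))‖ ^ 2))
    have hI2 := mul_nonneg hH3.1.le hI
    simp only [φ.map_zero', mul_zero, Real.exp_zero, one_mul, add_sub_add_left_eq_sub] at h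
    have h1 := hcoer _ (Eminus.sub_mem η₁.2 η₂.2)
    set d := φ.toFun k (x + η₁) - φ.toFun k (x + η₂) with hd
    have h2 := hp.le d
    have h3 := (neg_le_abs _).trans (P.le_opNorm₂ (Pi d) (Pi d))
    have hfn : ‖f η₁ - f η₂‖ = ‖Pi d‖ := by
      rw [hd, hp.sub]; rfl
    have hen : ‖η₁ - η₂‖ = ‖(η₁ : E) - η₂‖ := rfl
    rw [hfn, hen]
    refine le_of_sq_le_sq ?_ (norm_nonneg _) 
    rw [mul_pow, Real.sq_sqrt hq.le]
    have he := Real.exp_pos (2 * ν * k)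
    have h4 : c * ‖(η₁ : E) - η₂‖ ^ 2 ≤ Real.exp (2 * ν * k) * ((‖P‖ + 1) * ‖Pi d‖ ^ 2) := by
      have h5 : - P d d ≤ (‖P‖ + 1) * ‖Pi d‖ ^ 2 := by nlinarith [sq_nonneg ‖Pi d‖]
      have h6 := mul_le_mul_of_nonneg_left h5 he.le
      linarith
    have h7 := mul_le_mul_of_nonneg_left h4 (Real.exp_pos (-(2 * ν * k))).le
    rw [← mul_assoc, ← mul_assoc, ← Real.exp_add, neg_add_cancel, Real.exp_zero, one_mul] at h7
    simp only [q]
    rw [div_mul_eq_mul_div, div_le_iff₀ (by positivity)]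
    linarith
  obtain ⟨η, hη⟩ := aux_surj f hcont (Real.sqrt q) (Real.sqrt_pos.2 hq) hexp ⟨ζ, hζ⟩
  exact ⟨η, η.2, congrArg Subtype.val hη⟩

end

section
variable {E : Type*} [NormedAddCommGroup E] [NormedSpace ℝ E]
variable {H : Type*} [NormedAddCommGroup H] [InnerProductSpace ℝ H]

theorem aux_compact (φ : Semiflow E) (ι : E →L[ℝ] H) (ν : ℝ) (hν : 0 < ν)
    (hCOM : φ.IsCOM) (hS : φ.IsSmoothing ι) (w : ℝ → E) (hw : φ.IsCompleteTrajectory w)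
    (v : ℕ → ℝ → E)
    (hv : ∀ k : ℕ, ∀ s, -(k:ℝ) ≤ s → v k s = φ.toFun (s - (-(k:ℝ))) (v k (-(k:ℝ)))) (A : ℝ)
    (hA : ∀ᶠ k : ℕ in atTop,
      ∫ s in (-(k:ℝ))..0, Real.exp (2 * ν * s) * ‖ι (v k s) - ι (w s)‖ ^ 2 ≤ A) (m : ℕ) :
    ∃ K : Set E, IsCompact K ∧ ∀ᶠ k : ℕ in atTop, v k (-(m:ℝ)) ∈ K := by
  obtain ⟨τ, C, hτ, hC, hSm⟩ := hS
  obtain ⟨σ, hσ, hcom⟩ := hCOM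
  have hm : (0:ℝ) ≤ m := Nat.cast_nonneg m
  set a : ℝ := -m - 1 - σ - τ with ha
  obtain ⟨R, hR⟩ := ((isCompact_Icc (a := a + τ) (b := a + 1 + τ)).image hw.1).isBounded.exists_norm_le
  set R2 : ℝ := Real.sqrt (C ^ 2 * (Real.exp (-(2 * ν * a)) * A)) with hR2
  have hKc := hcom (Metric.closedBall 0 (R2 + R)) Metric.isBounded_closedBall
  set K0 := closure (φ.toFun σ '' Metric.closedBall 0 (R2 + R)) with hK0
  refine ⟨(fun p : ℝ × E => φ.toFun p.1 p.2) '' (Icc 0 1 ×ˢ K0), ?_, ?_⟩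
  · refine (isCompact_Icc.prod hKc).image_of_continuousOn (φ.continuousOn'.mono ?_)
    rintro ⟨p, q⟩ ⟨h1, h2⟩
    exact ⟨h1.1, mem_univ _⟩
  · obtain ⟨N, hN⟩ := exists_nat_ge (-a)
    filter_upwards [hA, eventually_ge_atTop N] with k hk hkN
    have hkN : (N:ℝ) ≤ k := by exact_mod_cast hkN
    obtain ⟨s, hs, hb⟩ := aux_smooth φ ι ν τ C hν hτ hC hSm (v k) w (-(k:ℝ)) (hv k)
      (aux_complete φ w hw _) a A (by linarith) (by linarith) hk
    have hn : ‖v k (s + τ) - w (s + τ)‖ ≤ R2 := Real.le_sqrt_of_sq_le hb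
    have hn2 : ‖w (s + τ)‖ ≤ R := hR _ ⟨s + τ, ⟨by linarith [hs.1], by linarith [hs.2]⟩, rfl⟩
    have hmem : v k (s + τ) ∈ Metric.closedBall (0:E) (R2 + R) := by
      rw [mem_closedBall_zero_iff]
      calc ‖v k (s + τ)‖ = ‖(v k (s + τ) - w (s + τ)) + w (s + τ)‖ := by rw [sub_add_cancel]
        _ ≤ _ := norm_add_le _ _
        _ ≤ _ := add_le_add hn hn2
    have h2 : v k (s + τ + σ) ∈ K0 := by
      rw [aux_traj_mid φ (v k) _ (hv k) (s + τ) (by linarith [hs.1]) (s + τ + σ) (by linarith),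
        add_sub_cancel_left]
      exact subset_closure ⟨_, hmem, rfl⟩
    refine ⟨(-(m:ℝ) - (s + τ + σ), v k (s + τ + σ)), ⟨⟨?_, ?_⟩, h2⟩, ?_⟩
    · simp only; linarith [hs.2]
    · simp only; linarith [hs.1]
    · simp only
      rw [← aux_traj_mid φ (v k) _ (hv k) (s + τ + σ) (by linarith [hs.1]) _ (by linarith [hs.2])]

theorem aux_limit (φ : Semiflow E) (v : ℕ → ℝ → E)
    (hv : ∀ k : ℕ, ∀ s, -(k:ℝ) ≤ s → v k s = φ.toFun (s - (-(k:ℝ))) (v k (-(k:ℝ))))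
    (hK : ∀ m : ℕ, ∃ K : Set E, IsCompact K ∧ ∀ᶠ k : ℕ in atTop, v k (-(m:ℝ)) ∈ K) :
    ∃ u : ℝ → E, φ.IsCompleteTrajectory u ∧
      ∀ t, Tendsto (fun k => v k t) (hyperfilter ℕ) (𝓝 (u t)) := by
  have hle : (hyperfilter ℕ : Filter ℕ) ≤ atTop := by
    rw [← Nat.cofinite_eq_atTop]; exact hyperfilter_le_cofinite
  have hz : ∀ m : ℕ, ∃ z, Tendsto (fun k => v k (-(m:ℝ))) (hyperfilter ℕ) (𝓝 z) := by
    intro m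
    obtain ⟨K, hKc, hKm⟩ := hK m
    obtain ⟨z, -, hz⟩ := hKc.ultrafilter_le_nhds ((hyperfilter ℕ).map fun k => v k (-(m:ℝ))) (by
      rw [le_principal_iff]
      exact hle hKm)
    exact ⟨z, hz⟩
  have hev : ∀ s : ℝ, ∀ᶠ k : ℕ in (hyperfilter ℕ : Filter ℕ), -(k:ℝ) ≤ s := by
    intro s
    refine hle ?_
    obtain ⟨N, hN⟩ := exists_nat_ge (-s)
    filter_upwards [eventually_ge_atTop N] with k hk
    have : (N:ℝ) ≤ k := by exact_mod_cast hk
    linarith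
  have hstep : ∀ (s t : ℝ) (z : E), 0 ≤ t → Tendsto (fun k => v k s) (hyperfilter ℕ) (𝓝 z) →
      Tendsto (fun k => v k (t + s)) (hyperfilter ℕ) (𝓝 (φ.toFun t z)) := by
    intro s t z ht h
    refine (aux_tendsto φ (t := fun _ => t) tendsto_const_nhds
      (Eventually.of_forall fun _ => ht) ht h).congr' ?_
    filter_upwards [hev s] with k hk
    rw [aux_traj_mid φ (v k) _ (hv k) s hk (t + s) (by linarith), add_sub_cancel_right]
  have hall : ∀ t : ℝ, ∃ z, Tendsto (fun k => v k t) (hyperfilter ℕ) (𝓝 z) := by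
    intro t
    obtain ⟨m, hm⟩ := exists_nat_ge (-t)
    obtain ⟨z, hz⟩ := hz m
    have := hstep (-(m:ℝ)) (t + m) z (by linarith) hz
    rw [add_neg_cancel_right] at this
    exact ⟨_, this⟩
  choose u hu using hall
  have huc : ∀ t : ℝ, 0 ≤ t → ∀ s : ℝ, u (t + s) = φ.toFun t (u s) := fun t ht s =>
    tendsto_nhds_unique (hu (t + s)) (hstep s t (u s) ht (hu s))
  refine ⟨u, ⟨?_, huc⟩, hu⟩
  rw [continuous_iff_continuousAt]
  intro t
  refine (aux_traj_cont φ u (t - 1) fun s hs => ?_).continuousAt (Ici_mem_nhds (by linarith))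
  rw [← huc _ (by linarith)]; congr 1; ring

theorem aux_surjective (φ : Semiflow E) (ι : E →L[ℝ] H) (P : E →L[ℝ] E →L[ℝ] ℝ)
    (Eplus Eminus : Submodule ℝ E) [FiniteDimensional ℝ ↥Eminus] (hH1 : Semiflow.IsH1 P Eplus Eminus)
    (Pi : E → E) (hp : AuxProj P Eminus Pi) (δ τV ν : ℝ)
    (hH3 : φ.IsH3 ι P δ τV ν) (hCOM : φ.IsCOM) (hS : φ.IsSmoothing ι)
    (w : ℝ → E) (hw : φ.IsAmenableTrajectory ι ν w) (ζ : E) (hζ : ζ ∈ Eminus) :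
    ∃ u : ℝ → E, φ.IsAmenableTrajectory ι ν u ∧ Pi (u 0) = ζ := by
  have hδ := hH3.1
  have hτV := hH3.2.1
  have hν := hH3.2.2.1
  have hη : ∀ k : ℕ, ∃ η : E, τV ≤ k → η ∈ Eminus ∧ Pi (φ.toFun k (w (-(k:ℝ)) + η)) = ζ := by
    intro k
    by_cases h : τV ≤ k
    · obtain ⟨η, h1, h2⟩ := aux_shoot φ ι P Eplus Eminus hH1 Pi hp δ τV ν hH3 k (Nat.cast_nonneg k) h
        (w (-(k:ℝ))) ζ hζ
      exact ⟨η, fun _ => ⟨h1, h2⟩⟩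
    · exact ⟨0, fun h2 => absurd h2 h⟩
  choose η hη using hη
  let v : ℕ → ℝ → E := fun k s => φ.toFun (s - (-(k:ℝ))) (w (-(k:ℝ)) + η k)
  have hvk : ∀ k : ℕ, v k (-(k:ℝ)) = w (-(k:ℝ)) + η k := by
    intro k; simp only [v]; rw [sub_self, φ.map_zero']
  have hv : ∀ k : ℕ, ∀ s, -(k:ℝ) ≤ s → v k s = φ.toFun (s - (-(k:ℝ))) (v k (-(k:ℝ))) := by
    intro k s _; rw [hvk]
  have hv0 : ∀ k : ℕ, τV ≤ k → Pi (v k 0) = ζ := by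
    intro k hk
    have := (hη k hk).2
    simp only [v]; rwa [sub_neg_eq_add, zero_add]
  have hneg : ∀ k : ℕ, τV ≤ k → P (η k) (η k) ≤ 0 := by
    intro k hk
    by_cases h0 : η k = 0
    · simp [h0]
    · exact (hH1.2.2.2.2.2 _ (hη k hk).1 h0).le
  have hmain : ∀ k : ℕ, τV ≤ k → ∀ r, -(k:ℝ) + τV ≤ r →
      Real.exp (2 * ν * r) * P (v k r - w r) (v k r - w r) +
      δ * ∫ s in (-(k:ℝ))..r, Real.exp (2 * ν * s) * ‖ι (v k s) - ι (w s)‖ ^ 2 ≤ 0 := by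
    intro k hk r hr
    refine (aux_H3traj φ ι P δ τV ν hH3 (v k) w (-(k:ℝ)) r (by linarith) (by linarith) (hv k)
      (aux_complete φ w hw.1 _)).trans ?_
    rw [hvk, add_sub_cancel_left]
    exact mul_nonpos_of_nonneg_of_nonpos (Real.exp_pos _).le (hneg k hk)
  obtain ⟨N, hN⟩ := exists_nat_ge τV
  have hevk : ∀ᶠ k : ℕ in atTop, τV ≤ k := by
    filter_upwards [eventually_ge_atTop N] with k hk
    have : (N:ℝ) ≤ k := by exact_mod_cast hk
    linarith
  set A : ℝ := - P (ζ - Pi (w 0)) (ζ - Pi (w 0)) / δ with hA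
  have hbd : ∀ᶠ k : ℕ in atTop,
      ∫ s in (-(k:ℝ))..0, Real.exp (2 * ν * s) * ‖ι (v k s) - ι (w s)‖ ^ 2 ≤ A := by
    filter_upwards [hevk] with k hk
    have h := hmain k hk 0 (by linarith)
    have h2 := hp.le (v k 0 - w 0)
    rw [hp.sub, hv0 k hk] at h2
    rw [hA, le_div_iff₀ hδ]
    simp only [mul_zero, Real.exp_zero, one_mul] at h
    linarith
  obtain ⟨u, huc, hul⟩ := aux_limit φ v hv
    (aux_compact φ ι ν hν hCOM hS w hw.1 v hv A hbd)
  have hle : (hyperfilter ℕ : Filter ℕ) ≤ atTop := by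
    rw [← Nat.cofinite_eq_atTop]; exact hyperfilter_le_cofinite
  have hneg2 : ∀ r : ℝ, P (u r - w r) (u r - w r) ≤ 0 := by
    intro r
    have hd : Tendsto (fun k => v k r - w r) (hyperfilter ℕ) (𝓝 (u r - w r)) :=
      (hul r).sub tendsto_const_nhds
    have hPc : Continuous fun x : E => P x x := by fun_prop
    refine le_of_tendsto ((hPc.tendsto _).comp hd) (hle ?_)
    obtain ⟨N2, hN2⟩ := exists_nat_ge (τV - r)
    filter_upwards [hevk, eventually_ge_atTop N2] with k hk hk2
    have hk2 : (N2:ℝ) ≤ k := by exact_mod_cast hk2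
    have h := hmain k hk r (by linarith)
    have hI := intervalIntegral.integral_nonneg (μ := volume) (a := -(k:ℝ)) (b := r) (by linarith)
      (fun s _ => (by positivity : 0 ≤ Real.exp (2 * ν * s) * ‖ι (v k s) - ι (w s)‖ ^ 2))
    have hI2 := mul_nonneg hδ.le hI
    have h3 : Real.exp (2 * ν * r) * P (v k r - w r) (v k r - w r) ≤ 0 := by linarith
    exact nonpos_of_mul_nonpos_right h3 (Real.exp_pos _)
  have hζ0 : Pi (u 0) = ζ := by
    refine tendsto_nhds_unique ((hp.cont.tendsto _).comp (hul 0)) ?_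
    refine tendsto_const_nhds.congr' (hle ?_)
    filter_upwards [hevk] with k hk using (hv0 k hk).symm
  refine ⟨u, ⟨huc, ?_⟩, hζ0⟩
  have hcu := huc.1
  have hcw := hw.1.1
  have hgi : IntegrableOn (fun s => Real.exp (2 * ν * s) * ‖ι (u s) - ι (w s)‖ ^ 2) (Iic 0) := by
    have hgc : Continuous (fun s => Real.exp (2 * ν * s) * ‖ι (u s) - ι (w s)‖ ^ 2) := by fun_prop
    refine integrableOn_Iic_of_intervalIntegral_norm_bounded (ι := ℕ) (l := atTop)
      (a := fun k : ℕ => -(k:ℝ)) (- P (u 0 - w 0) (u 0 - w 0) / δ) 0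
      (fun k => (hgc.integrableOn_Icc).mono_set Ioc_subset_Icc_self)
      (tendsto_neg_atTop_atBot.comp tendsto_natCast_atTop_atTop) ?_
    filter_upwards [hevk] with k hk
    have h := aux_H3traj φ ι P δ τV ν hH3 u w (-(k:ℝ)) 0 (by linarith) (by linarith)
      (aux_complete φ u huc _) (aux_complete φ w hw.1 _)
    have h2 := mul_nonpos_of_nonneg_of_nonpos (Real.exp_pos (2 * ν * (-(k:ℝ)))).le (hneg2 (-(k:ℝ)))
    rw [le_div_iff₀ hδ]
    simp only [mul_zero, Real.exp_zero, one_mul] at h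
    have : ∀ s, ‖Real.exp (2 * ν * s) * ‖ι (u s) - ι (w s)‖ ^ 2‖ =
        Real.exp (2 * ν * s) * ‖ι (u s) - ι (w s)‖ ^ 2 := fun s =>
      Real.norm_of_nonneg (by positivity)
    simp only [this]
    linarith
  have hgc : Continuous (fun s => Real.exp (2 * ν * s) * ‖ι (u s)‖ ^ 2) := by fun_prop
  refine ((hgi.add hw.2).const_mul 2).mono' hgc.aestronglyMeasurable
    (Eventually.of_forall fun s => ?_)
  rw [Real.norm_of_nonneg (by positivity)]
  have hn : ‖ι (u s)‖ ^ 2 ≤ 2 * (‖ι (u s) - ι (w s)‖ ^ 2 + ‖ι (w s)‖ ^ 2) := by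
    have := norm_add_le (ι (u s) - ι (w s)) (ι (w s))
    rw [sub_add_cancel] at this
    nlinarith [sq_nonneg (‖ι (u s) - ι (w s)‖ - ‖ι (w s)‖), norm_nonneg (ι (u s))]
  have := mul_le_mul_of_nonneg_left hn (Real.exp_pos (2 * ν * s)).le
  simp only [_root_.Pi.add_apply]
  linarith

end

theorem amenableSet_empty_or_homeomorph
    {E : Type*} [NormedAddCommGroup E] [NormedSpace ℝ E]
    {H : Type*} [NormedAddCommGroup H] [InnerProductSpace ℝ H]
    (ι : E →L[ℝ] H) (hι : Function.Injective ι)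
    (φ : Semiflow E)
    (P : E →L[ℝ] E →L[ℝ] ℝ) (Eplus Eminus : Submodule ℝ E)
    (hH1 : Semiflow.IsH1 P Eplus Eminus)
    (j : ℕ) [FiniteDimensional ℝ ↥Eminus] (hH2 : Module.finrank ℝ ↥Eminus = j)
    (δ τV ν : ℝ) (hH3 : φ.IsH3 ι P δ τV ν)
    (hCOM : φ.IsCOM) (hS : φ.IsSmoothing ι)
    (Pi : E → E) (hPi : Semiflow.IsVProjector P Eminus Pi) :
    φ.amenableSet ι ν = ∅ ∨
      ∃ h : ↥(φ.amenableSet ι ν) ≃ₜ ↥Eminus,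
        ∀ x : ↥(φ.amenableSet ι ν), (↑(h x) : E) = Pi (↑x : E) := by
  rcases Set.eq_empty_or_nonempty (φ.amenableSet ι ν) with hem | ⟨w0, w, hw, -⟩
  · exact Or.inl hem
  right
  have hp := aux_proj P Eplus Eminus hH1 Pi hPi
  let f : ↥(φ.amenableSet ι ν) → ↥Eminus := fun x => ⟨Pi x, hp.mem _⟩
  have hinj : Function.Injective f := by
    rintro ⟨x, u, hu, rfl⟩ ⟨y, u2, hu2, rfl⟩ hxy
    have hxy2 : Pi (u 0) = Pi (u2 0) := congrArg Subtype.val hxy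
    have h := aux_pair φ ι P δ τV ν hH3 hS u u2 hu hu2 0 le_rfl
    rw [intervalIntegral.integral_same, mul_zero, add_zero] at h
    have := hp.eq_zero (u 0 - u2 0) (by rw [hp.sub, hxy2, sub_self]) h
    exact Subtype.ext (sub_eq_zero.1 this)
  have hsurj : Function.Surjective f := by
    rintro ⟨ζ, hζ⟩
    obtain ⟨u, hu, hu0⟩ := aux_surjective φ ι P Eplus Eminus hH1 Pi hp δ τV ν hH3 hCOM hS w hw ζ hζ
    exact ⟨⟨u 0, u, hu, rfl⟩, Subtype.ext hu0⟩
  let e := Equiv.ofBijective f ⟨hinj, hsurj⟩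
  have hef : ∀ ζ : Eminus, Pi (e.symm ζ : E) = ζ := fun ζ =>
    congrArg Subtype.val (e.apply_symm_apply ζ)
  have hcont : Continuous f := Continuous.subtype_mk (hp.cont.comp continuous_subtype_val) _
  have hcont2 : Continuous e.symm := by
    rw [continuous_iff_ultrafilter]
    intro ζ F hF
    rw [tendsto_subtype_rng]
    have hex : ∀ ξ : Eminus, ∃ u : ℝ → E, φ.IsAmenableTrajectory ι ν u ∧ u 0 = (e.symm ξ : E) :=
      fun ξ => (e.symm ξ).2
    choose U hU hU0 using hex
    have := aux_inv_cont φ ι P Eminus Pi hp δ τV ν hH3 hS F U (U ζ) hU (hU ζ) (by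
      simp only [hU0, hef]
      exact (continuous_subtype_val.tendsto ζ).mono_left hF)
    simpa only [hU0] using this
  exact ⟨⟨e, hcont, hcont2⟩, fun x => rfl⟩
end
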